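/- The compactified Hurwitz space H̄(k,b), defined as the normalization of the Fulton–MacPherson configuration space P^1[b] in the function field of the Hurwitz space H(k,b), is a scheme with at worst finite quotient singularities. -/

import Mathlib

/-!
Statement 0: The compactified Hurwitz space `H̄(k,b)`, defined as the normalization of the
Fulton–MacPherson configuration space `P¹[b]` in the function field of the Hurwitz space
`H(k,b)`, is a scheme with at worst finite quotient singularities.

The geometric situation is encoded by the interface `HurwitzCompactification k b` below:
`Hur` plays the role of the Hurwitz space `H(k,b)` (a finite étale cover of the configuration
space of `b` ordered points of `ℙ¹`, the open part of `P¹[b]`), `FM` plays the role of the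
Fulton–MacPherson compactification `P¹[b]` (a smooth proper complex variety whose boundary is
a simple normal crossing divisor), and `Hbar` plays the role of the compactification
`H̄(k,b)` (the normalization of `FM` in the function field of `Hur`: a normal variety with a
finite dominant morphism to `FM`, containing `Hur` as a dense open subscheme, with the same
function field as `Hur`, and étale over the interior).
-/

open AlgebraicGeometry CategoryTheory

/-- `Spec ℂ`, the base of our complex varieties. -/
noncomputable abbrev SpecC : Scheme := Spec (CommRingCat.of ℂ)

/-- Affine `n`-space over `ℂ`. -/
noncomputable abbrev AffineSpaceC (n : ℕ) : Scheme :=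
  Spec (CommRingCat.of (MvPolynomial (Fin n) ℂ))

/-- The union of the coordinate hyperplanes `{xᵢ = 0}`, `i ∈ s`, in affine `n`-space:
the zero locus of the monomial `∏ i ∈ s, xᵢ`. -/
noncomputable def coordinateHyperplanes (n : ℕ) (s : Finset (Fin n)) :
    Set (AffineSpaceC n) :=
  (AffineSpaceC n).zeroLocus (U := ⊤)
    {(Scheme.ΓSpecIso (CommRingCat.of (MvPolynomial (Fin n) ℂ))).inv
      (∏ i ∈ s, MvPolynomial.X i)}

/-- A closed subset `D ⊆ Y` is a (simple) normal crossing divisor if, locally on `Y`, there is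
an étale morphism `g` to affine `n`-space under which `D` is the preimage of a union of
coordinate hyperplanes. -/
def IsSNCDivisor {Y : Scheme} (D : Set Y) : Prop :=
  IsClosed D ∧
    ∀ y : Y, ∃ (U : Y.Opens) (_ : y ∈ U) (n : ℕ) (s : Finset (Fin n))
      (g : U.toScheme ⟶ AffineSpaceC n), IsEtale g ∧
        ∀ u : U.toScheme, g.base u ∈ coordinateHyperplanes n s ↔ (U.ι.base u : Y) ∈ D

/-- The fixed subalgebra `R^G` of a `ℂ`-algebra `R` under an action of a group `G` by
`ℂ`-algebra automorphisms. -/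
def fixedSubalgebra (G : Type) [Group G] (R : Type) [CommRing R] [Algebra ℂ R]
    [MulSemiringAction G R] [SMulCommClass G ℂ R] : Subalgebra ℂ R where
  carrier := {r | ∀ g : G, g • r = r}
  mul_mem' {a b} ha hb g := by rw [smul_mul', ha g, hb g]
  add_mem' {a b} ha hb g := by rw [smul_add, ha g, hb g]
  algebraMap_mem' c g := by
    rw [Algebra.algebraMap_eq_smul_one, smul_comm, smul_one]

/-- A chart witnessing that, étale-locally at `x`, the scheme `X` is the quotient of a smooth
complex variety (here `Spec R`, `R` a smooth `ℂ`-algebra) by a finite group `G`: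
an étale morphism `Spec (R^G) ⟶ X` whose image contains `x`. -/
structure FiniteQuotientChart (X : Scheme) (x : X) where
  /-- the coordinate ring of the smooth local model -/
  R : Type
  [commRing : CommRing R]
  [alg : Algebra ℂ R]
  /-- the local model is a smooth affine complex variety -/
  smooth : Algebra.Smooth ℂ R
  /-- the finite group -/
  G : Type
  [group : Group G]
  [finite : Finite G]
  [action : MulSemiringAction G R]
  [smulComm : SMulCommClass G ℂ R]
  /-- the étale chart from the quotient `Spec (R^G)` to `X` -/
  f : Spec (CommRingCat.of (fixedSubalgebra G R)) ⟶ X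
  etale : IsEtale f
  mem : x ∈ Set.range f.base

/-- A scheme has (at worst) finite quotient singularities if, étale-locally around every point,
it is the quotient of a smooth complex variety by a finite group. -/
def HasFiniteQuotientSingularities (X : Scheme) : Prop :=
  ∀ x : X, Nonempty (FiniteQuotientChart X x)

/-- A scheme is normal if all of its local rings are integrally closed domains. -/
def IsNormalScheme (X : Scheme) : Prop :=
  ∀ x : X, IsIntegrallyClosed (X.presheaf.stalk x)

/-- The geometric setting of Fontanari's note: the Hurwitz space `Hur = H(k,b)` of smooth
degree `k` covers of `ℙ¹` branched over `b` ordered points, the Fulton–MacPherson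
compactification `FM = ℙ¹[b]` of the configuration space of `b` ordered points of `ℙ¹`,
and the compactified Hurwitz space `Hbar = H̄(k,b)`, the normalization of `FM` in the
function field of `Hur`. -/
structure HurwitzCompactification (k b : ℕ) where
  /-- the Hurwitz space `H(k,b)` -/
  Hur : Scheme
  /-- the Fulton–MacPherson compactification `ℙ¹[b]` -/
  FM : Scheme
  /-- the compactified Hurwitz space `H̄(k,b)` -/
  Hbar : Scheme
  /-- structure morphisms over `ℂ` -/
  sH : Hur ⟶ SpecC
  sFM : FM ⟶ SpecC
  sHbar : Hbar ⟶ SpecC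
  -- all three spaces are complex varieties:
  [integralH : IsIntegral Hur]
  [integralFM : IsIntegral FM]
  [integralHbar : IsIntegral Hbar]
  sepH : IsSeparated sH
  sepFM : IsSeparated sFM
  sepHbar : IsSeparated sHbar
  ftH : LocallyOfFiniteType sH
  ftFM : LocallyOfFiniteType sFM
  ftHbar : LocallyOfFiniteType sHbar
  qcH : QuasiCompact sH
  qcHbar : QuasiCompact sHbar
  /-- `ℙ¹[b]` is a smooth proper complex variety … -/
  smoothFM : IsSmooth sFM
  properFM : IsProper sFM
  /-- … whose boundary is a simple normal crossing divisor. -/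
  boundary : Set FM
  sncBoundary : IsSNCDivisor boundary
  /-- the interior of `ℙ¹[b]`, i.e. the configuration space `(ℙ¹)ᵇ \ Δ` of `b` ordered
  points of `ℙ¹` (`Δ` the union of the large diagonals) -/
  interior : FM.Opens
  interiorEq : (interior : Set FM) = boundaryᶜ
  /-- the Hurwitz space is a finite étale cover of the configuration space (the branch-point
  map of `H(k,b)`) -/
  q : Hur ⟶ interior.toScheme
  [qEtale : IsEtale q]
  [qFinite : IsFinite q]
  wH : q ≫ Scheme.Opens.ι interior ≫ sFM = sH
  /-- `H̄(k,b)` is the normalization of `ℙ¹[b]` in the function field of `H(k,b)`; in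
  particular it is normal, … -/
  normalHbar : IsNormalScheme Hbar
  /-- … it carries a finite dominant morphism `p` to `ℙ¹[b]`, … -/
  p : Hbar ⟶ FM
  [pFinite : IsFinite p]
  [pDominant : IsDominant p]
  wHbar : p ≫ sFM = sHbar
  /-- … it contains the Hurwitz space as a dense open subscheme, … -/
  j : Hur ⟶ Hbar
  [jOpen : IsOpenImmersion j]
  jDense : Dense (Set.range j.base)
  compat : j ≫ p = q ≫ Scheme.Opens.ι interior
  /-- … it has the same function field as the Hurwitz space, … -/
  functionFieldIso : Nonempty (Hbar.functionField ≅ Hur.functionField)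
  /-- … and `p` is (finite) étale over the interior of `ℙ¹[b]`. -/
  pEtaleInterior : IsEtale (p ∣_ interior)

section ModP1
open Polynomial

section DVRPart

variable {k L : Type} [CommRing k] [Field L] [Algebra k L]

structure UData (O : Subring L) (π : L) : Prop where
  mem : π ∈ O
  inv_not_mem : π⁻¹ ∉ O
  fac : ∀ c : L, c ≠ 0 → ∃ u ∈ O, u⁻¹ ∈ O ∧ ∃ m : ℤ, c = u * π ^ m

/-- logarithmic derivative -/
def ldv (D : Derivation k L L) (c : L) : L := D c / c

lemma ldv_zero (D : Derivation k L L) : ldv D 0 = 0 := by simp [ldv]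

lemma ldv_mul (D : Derivation k L L) {a b : L} (ha : a ≠ 0) (hb : b ≠ 0) :
    ldv D (a * b) = ldv D a + ldv D b := by
  simp only [ldv, Derivation.leibniz, smul_eq_mul]
  field_simp
  ring

lemma ldv_one (D : Derivation k L L) : ldv D 1 = 0 := by simp [ldv]

lemma ldv_inv (D : Derivation k L L) {a : L} (ha : a ≠ 0) : ldv D a⁻¹ = - ldv D a := by
  have := ldv_mul D ha (inv_ne_zero ha)
  rw [mul_inv_cancel₀ ha, ldv_one] at this
  linear_combination -this

lemma ldv_pow (D : Derivation k L L) {a : L} (ha : a ≠ 0) (n : ℕ) :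
    ldv D (a ^ n) = n * ldv D a := by
  induction n with
  | zero => simp [ldv_one]
  | succ n ih => rw [pow_succ, ldv_mul D (pow_ne_zero _ ha) ha, ih]; push_cast; ring

lemma ldv_zpow (D : Derivation k L L) {a : L} (ha : a ≠ 0) (n : ℤ) :
    ldv D (a ^ n) = n * ldv D a := by
  obtain ⟨m, rfl | rfl⟩ := n.eq_nat_or_neg
  · simp [ldv_pow D ha]
  · rw [zpow_neg, ldv_inv D (zpow_ne_zero _ ha)]; simp [ldv_pow D ha]

lemma D_eq_ldv (D : Derivation k L L) (c : L) : D c = c * ldv D c := by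
  by_cases h : c = 0
  · simp [h]
  · rw [ldv]; field_simp

/-- `D (f(b)) - f'(b) D b` lies in any `O`-stable additive subgroup containing the `D a`. -/
lemma D_eval (D : Derivation k L L) (O A0 : Subring L) (J : AddSubgroup L)
    (hJ : ∀ o ∈ O, ∀ j ∈ J, o * j ∈ J) (hDA : ∀ a ∈ A0, D a ∈ J)
    (f : L[X]) (hf : ∀ n, f.coeff n ∈ A0) (b : L) (hb : b ∈ O) :
    D (f.eval b) - f.derivative.eval b * D b ∈ J := by
  rw [f.as_sum_range]
  simp only [eval_finsetSum, map_sum, eval_monomial, derivative_monomial, Finset.sum_mul,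
    ← Finset.sum_sub_distrib]
  refine sum_mem fun i _ => ?_
  have : D (f.coeff i * b ^ i) - f.coeff i * i * b ^ (i - 1) * D b = b ^ i * D (f.coeff i) := by
    simp only [Derivation.leibniz, smul_eq_mul, Derivation.leibniz_pow, nsmul_eq_mul]
    ring
  rw [this]
  exact hJ _ (pow_mem hb i) _ (hDA _ (hf i))

structure DVRSetup (O A0 B0 : Subring L) (π : L) : Prop extends UData O π where
  natInv : ∀ n : ℕ, n ≠ 0 → (n : L)⁻¹ ∈ O
  natNe : ∀ n : ℕ, n ≠ 0 → (n : L) ≠ 0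
  A_le : A0 ≤ O
  B_le : B0 ≤ O
  units : ∀ u ∈ O, u⁻¹ ∈ O → u ≠ 0 → ∃ b ∈ B0, ∃ s ∈ B0, b ≠ 0 ∧ s ≠ 0 ∧ u = b / s
    ∧ b⁻¹ ∈ O ∧ s⁻¹ ∈ O
  res : ∀ b ∈ B0, ∃ f : L[X], (∀ n, f.coeff n ∈ A0) ∧ π⁻¹ * f.eval b ∈ O ∧
    f.derivative.eval b ≠ 0 ∧ (f.derivative.eval b)⁻¹ ∈ O

variable {O A0 B0 : Subring L} {π : L}

lemma UData.ne_zero (h : UData O π) : π ≠ 0 := by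
  intro h0; apply h.inv_not_mem; rw [h0, inv_zero]; exact zero_mem _

/-- maximal ideal -/
def mId (O : Subring L) (π : L) : AddSubgroup L where
  carrier := {x | π⁻¹ * x ∈ O}
  add_mem' := by intro a b ha hb; simp only [Set.mem_ofPred_eq, mul_add] at *; exact add_mem ha hb
  zero_mem' := by simp
  neg_mem' := by intro a ha; simp only [Set.mem_ofPred_eq, mul_neg] at *; exact neg_mem ha

lemma mem_mId {x : L} : x ∈ mId O π ↔ π⁻¹ * x ∈ O := Iff.rfl

lemma mId_mul {o j : L} (ho : o ∈ O) (hj : j ∈ mId O π) : o * j ∈ mId O π := by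
  rw [mem_mId] at *
  have := mul_mem ho hj
  convert this using 1; ring

lemma UData.mId_le (h : UData O π) {j : L} (hj : j ∈ mId O π) : j ∈ O := by
  have := mul_mem h.mem hj
  rwa [← mul_assoc, mul_inv_cancel₀ h.ne_zero, one_mul] at this

/-- key computation for a unit from `B0`: `w = π ^ r` -/
lemma DVRSetup.unitB (S : DVRSetup O A0 B0 π) (D : Derivation k L L) (w : L) (hw : w ∈ O)
    (hD : ∀ c, w * ldv D c ∈ O) (hDA : ∀ a ∈ A0, w * D a ∈ mId O π)
    (b : L) (hb : b ∈ B0) (hbi : b⁻¹ ∈ O) : w * ldv D b ∈ mId O π := by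
  obtain ⟨f, hfA, hfm, hf0, hfi⟩ := S.res b hb
  have h1 := D_eval (w • D) O A0 (mId O π) (fun o ho j hj => mId_mul ho hj)
    (by simpa using hDA) f hfA b (S.B_le hb)
  simp only [Derivation.smul_apply, smul_eq_mul] at h1
  have h2 : w * D (f.eval b) ∈ mId O π := by
    rw [D_eq_ldv]
    have := mul_mem (hD (f.eval b)) hfm
    rw [mem_mId]; convert this using 1; ring
  have h3 := sub_mem h2 h1
  have h4 := mId_mul (mul_mem hfi hbi) h3
  convert h4 using 1
  rw [ldv]
  field_simp
  ring

lemma DVRSetup.unit (S : DVRSetup O A0 B0 π) (D : Derivation k L L) (w : L) (hw : w ∈ O)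
    (hD : ∀ c, w * ldv D c ∈ O) (hDA : ∀ a ∈ A0, w * D a ∈ mId O π)
    (u : L) (hu : u ∈ O) (hui : u⁻¹ ∈ O) : w * ldv D u ∈ mId O π := by
  by_cases h0 : u = 0
  · rw [h0, ldv_zero, mul_zero]; exact zero_mem _
  obtain ⟨b, hb, s, hs, hb0, hs0, rfl, hbi, hsi⟩ := S.units u hu hui h0
  rw [div_eq_mul_inv, ldv_mul D hb0 (inv_ne_zero hs0), ldv_inv D hs0, mul_add, mul_neg]
  exact add_mem (S.unitB D w hw hD hDA b hb hbi) (neg_mem (S.unitB D w hw hD hDA s hs hsi))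

/-- for `x = v * π ^ e`, `c = u * π ^ m`: `w * (ldv c - (m/e) ldv x)` is in the maximal ideal. -/
lemma DVRSetup.gen (S : DVRSetup O A0 B0 π) (D : Derivation k L L) (w : L) (hw : w ∈ O)
    (hD : ∀ c, w * ldv D c ∈ O) (hDA : ∀ a ∈ A0, w * D a ∈ mId O π)
    (x v : L) (e : ℕ) (he : e ≠ 0) (hv : v ∈ O) (hvi : v⁻¹ ∈ O) (hx0 : x ≠ 0)
    (hx : x = v * π ^ e) (c u : L) (m : ℤ) (hc0 : c ≠ 0) (hu : u ∈ O) (hui : u⁻¹ ∈ O)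
    (hc : c = u * π ^ m) :
    w * (e * ldv D c - m * ldv D x) ∈ mId O π := by
  have hp := S.ne_zero
  have hv0 : v ≠ 0 := by rintro rfl; simp [hx] at hx0
  have hu0 : u ≠ 0 := by rintro rfl; simp [hc] at hc0
  have h1 : ldv D x = ldv D v + e * ldv D π := by
    rw [hx, ldv_mul D hv0 (pow_ne_zero _ hp), ldv_pow D hp]
  have h2 : ldv D c = ldv D u + m * ldv D π := by
    rw [hc, ldv_mul D hu0 (zpow_ne_zero _ hp), ldv_zpow D hp]
  have h3 := S.unit D w hw hD hDA u hu hui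
  have h4 := S.unit D w hw hD hDA v hv hvi
  have h5 : (e : L) ∈ O := natCast_mem O e
  have h6 : (m : L) ∈ O := intCast_mem O m
  have := sub_mem (mId_mul h5 h3) (mId_mul h6 h4)
  convert this using 1
  rw [h1, h2]; ring

lemma DVRSetup.descend (S : DVRSetup O A0 B0 π) (D : Derivation k L L)
    (hDA : ∀ a ∈ A0, D a ∈ A0) (x v : L) (e : ℕ) (he : e ≠ 0) (hv : v ∈ O) (hvi : v⁻¹ ∈ O)
    (hx0 : x ≠ 0) (hx : x = v * π ^ e) (hDx : ldv D x ∈ O) (r : ℕ)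
    (hr : ∀ c, π ^ r * ldv D c ∈ O) : ∀ c, ldv D c ∈ O := by
  have hp := S.ne_zero
  induction r with
  | zero => simpa using hr
  | succ r ih =>
    apply ih
    intro c
    by_cases hc0 : c = 0
    · rw [hc0, ldv_zero, mul_zero]; exact zero_mem _
    obtain ⟨u, hu, hui, m, hc⟩ := S.fac c hc0
    have hw : ∀ z ∈ O, π ^ (r + 1) * z ∈ mId O π := by
      intro z hz
      rw [mem_mId]
      have := mul_mem (pow_mem S.mem r) hz
      convert this using 1
      field_simp
      ring
    have h1 := S.gen D (π ^ (r + 1)) (pow_mem S.mem _) hr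
      (fun a ha => hw _ (S.A_le (hDA a ha))) x v e he hv hvi hx0 hx c u m hc0 hu hui hc
    have h2 := mId_mul (intCast_mem O m) (hw _ hDx)
    have h3 := mId_mul (S.natInv e he) (add_mem h1 h2)
    rw [mem_mId] at h3
    have he' := S.natNe e he
    convert h3 using 1
    field_simp
    ring


lemma UData.zpow_mem (h : UData O π) {s : ℤ} (hs : 0 ≤ s) : π ^ s ∈ O := by
  lift s to ℕ using hs
  simpa using pow_mem h.mem s

lemma UData.zpow_nonneg (h : UData O π) {U : L} (hU0 : U ≠ 0) (hUi : U⁻¹ ∈ O) {s : ℤ}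
    (hs : U * π ^ s ∈ O) : 0 ≤ s := by
  by_contra! hlt
  have h1 : π ^ s ∈ O := by
    have := mul_mem hUi hs
    rwa [← mul_assoc, inv_mul_cancel₀ hU0, one_mul] at this
  have h2 : π ^ (-s - 1) ∈ O := h.zpow_mem (by omega)
  have h3 := mul_mem h1 h2
  rw [← zpow_add₀ h.ne_zero] at h3
  have : s + (-s - 1) = -1 := by ring
  rw [this, zpow_neg_one] at h3
  exact h.inv_not_mem h3

lemma UData.mem_of_pow_mem (h : UData O π) {c : L} {N : ℕ} (hN : N ≠ 0) (hc : c ^ N ∈ O) :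
    c ∈ O := by
  by_cases h0 : c = 0
  · rw [h0]; exact zero_mem _
  obtain ⟨u, hu, hui, m, rfl⟩ := h.fac c h0
  have hu0 : u ≠ 0 := by rintro rfl; simp at h0
  have h1 : (u * π ^ m) ^ N = u ^ N * π ^ (m * N) := by
    rw [mul_pow, zpow_mul]; simp
  rw [h1] at hc
  have := h.zpow_nonneg (pow_ne_zero N hu0) (by rw [← inv_pow]; exact pow_mem hui N) hc
  have hm : 0 ≤ m := by
    by_contra! hlt
    have : m * N < 0 := mul_neg_of_neg_of_pos hlt (by positivity)
    omega
  exact mul_mem hu (h.zpow_mem hm)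

lemma UData.cases (h : UData O π) {x : L} (hx : x ∈ O) (hx0 : x ≠ 0) :
    x⁻¹ ∈ O ∨ ∃ v ∈ O, v⁻¹ ∈ O ∧ ∃ e : ℕ, e ≠ 0 ∧ x = v * π ^ e := by
  obtain ⟨u, hu, hui, m, rfl⟩ := h.fac x hx0
  have hu0 : u ≠ 0 := by rintro rfl; simp at hx0
  have := h.zpow_nonneg hu0 hui hx
  lift m to ℕ using this
  by_cases hm : m = 0
  · left; simpa [hm] using hui
  · right; exact ⟨u, hu, hui, m, hm, by simp⟩

lemma DVRSetup.final (S : DVRSetup O A0 B0 π) {n : ℕ} (x : Fin n → L) (hxA : ∀ j, x j ∈ A0)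
    (hx0 : ∀ j, x j ≠ 0) (D : Fin n → Derivation k L L) (hDA : ∀ i, ∀ a ∈ A0, D i a ∈ A0)
    (hDx : ∀ i j, D i (x j) = if i = j then 1 else 0)
    (hbd : ∀ i, ∃ r : ℕ, ∀ c, π ^ r * ldv (D i) c ∈ O)
    (hC : (∀ j, (x j)⁻¹ ∈ O) → ∀ i, ∀ c ∈ O, D i c ∈ O)
    (N : ℕ) (hN : N ≠ 0)
    (hNe : ∀ j, ∀ v ∈ O, v⁻¹ ∈ O → ∀ e : ℕ, e ≠ 0 → x j = v * π ^ e → e ∣ N)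
    (i : Fin n) (c : L) (a : Fin n → ℕ) (hc : c ^ N * ∏ j, x j ^ a j ∈ O) :
    (N * D i c + a i * c / x i) ^ N * x i ^ (N - 1) * ∏ j, x j ^ a j ∈ O := by
  have hp := S.ne_zero
  have hxO : ∀ j, x j ∈ O := fun j => S.A_le (hxA j)
  by_cases hc0 : c = 0
  · simp [hc0, hN]
  by_cases hA : ∀ j, (x j)⁻¹ ∈ O
  · have h1 : c ∈ O := by
      apply S.mem_of_pow_mem hN
      have : (∏ j, x j ^ a j)⁻¹ ∈ O := by
        rw [← Finset.prod_inv_distrib]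
        exact prod_mem fun j _ => by rw [← inv_pow]; exact pow_mem (hA j) _
      have h2 := mul_mem hc this
      rwa [mul_assoc, mul_inv_cancel₀ (Finset.prod_ne_zero_iff.mpr fun j _ => pow_ne_zero _ (hx0 j)),
        mul_one] at h2
    have h2 : (N * D i c + a i * c / x i) ∈ O := by
      refine add_mem (mul_mem (natCast_mem _ _) (hC hA i c h1)) ?_
      rw [div_eq_mul_inv]
      exact mul_mem (mul_mem (natCast_mem _ _) h1) (hA i)
    exact mul_mem (mul_mem (pow_mem h2 _) (pow_mem (hxO i) _))
      (prod_mem fun j _ => pow_mem (hxO j) _)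
  rcases S.cases (hxO i) (hx0 i) with hxi | ⟨v, hv, hvi, e, he, hxe⟩
  · push Not at hA
    obtain ⟨j, hj⟩ := hA
    obtain ⟨v, hv, hvi, e, he, hxe⟩ := (S.cases (hxO j) (hx0 j)).resolve_left hj
    have hij : i ≠ j := by rintro rfl; exact hj hxi
    obtain ⟨r, hr⟩ := hbd i
    have h1 := S.descend (D i) (hDA i) (x j) v e he hv hvi (hx0 j) hxe
      (by simp [ldv, hDx, hij, zero_mem]) r hr c
    have h2 : (N * D i c + a i * c / x i) = c * (N * ldv (D i) c + a i * (x i)⁻¹) := by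
      rw [D_eq_ldv]; ring
    rw [h2, mul_pow]
    have h3 : (N * ldv (D i) c + a i * (x i)⁻¹) ∈ O :=
      add_mem (mul_mem (natCast_mem _ _) h1) (mul_mem (natCast_mem _ _) hxi)
    have := mul_mem (mul_mem hc (pow_mem h3 N)) (pow_mem (hxO i) (N - 1))
    convert this using 1; ring
  · obtain ⟨r, hr⟩ := hbd i
    have hl : ∀ c, ldv (x i • D i) c = x i * ldv (D i) c := by
      intro c; simp [ldv, mul_div_assoc]
    have h1 := S.descend (x i • D i) (fun a ha => mul_mem (hxA i) (hDA i a ha))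
      (x i) v e he hv hvi (hx0 i) hxe
      (by rw [hl, ldv, hDx, if_pos rfl, mul_one_div_cancel (hx0 i)]; exact one_mem _) r
      (fun c => by
        rw [hl]
        have := mul_mem (hxO i) (hr c)
        convert this using 1; ring)
    have hxm : x i ∈ mId O π := by
      rw [mem_mId, hxe]
      obtain ⟨e', rfl⟩ := Nat.exists_eq_succ_of_ne_zero he
      have := mul_mem hv (pow_mem S.mem e')
      convert this using 1
      field_simp
      rw [pow_succ]; ring
    have hgen := S.gen (x i • D i) 1 (one_mem _) (by simpa using h1)
      (fun a ha => by
        rw [one_mul, Derivation.smul_apply, smul_eq_mul, mul_comm]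
        exact mId_mul (S.A_le (hDA i a ha)) hxm) (x i) v e he hv hvi (hx0 i) hxe
    have hlx : ldv (x i • D i) (x i) = 1 := by
      rw [hl, ldv, hDx, if_pos rfl, mul_one_div_cancel (hx0 i)]
    simp only [hlx, one_mul, mul_one] at hgen
    have hother : ∀ j, j ≠ i → (x j)⁻¹ ∈ O := by
      intro j hj
      by_contra hcon
      obtain ⟨v', hv', hvi', e', he', hxe'⟩ := (S.cases (hxO j) (hx0 j)).resolve_left hcon
      have := hgen (x j) v' e' (hx0 j) hv' hvi' (by simpa using hxe')
      rw [hl, ldv, hDx, if_neg hj.symm] at this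
      have h2 := mId_mul (neg_mem (S.natInv e' he')) this
      have h3 := S.natNe e' he'
      rw [mem_mId] at h2
      apply S.inv_not_mem
      convert h2 using 1
      simp
      field_simp
    obtain ⟨u, hu, hui, m, hcu⟩ := S.fac c hc0
    have hμ := hgen c u m hc0 hu hui hcu
    obtain ⟨N', hN'⟩ := hNe i v hv hvi e he hxe
    set μ := (e : L) * ldv (x i • D i) c - m with hμd
    have hu0 : u ≠ 0 := by rintro rfl; simp [hcu] at hc0
    have hv0 : v ≠ 0 := by rintro rfl; exact hx0 i (by simp [hxe])
    set q := ∏ j ∈ Finset.univ.erase i, x j ^ a j with hq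
    have hqO : q ∈ O := prod_mem fun j _ => pow_mem (hxO j) _
    have hqi : q⁻¹ ∈ O := by
      rw [hq, ← Finset.prod_inv_distrib]
      exact prod_mem fun j hj => by
        rw [← inv_pow]; exact pow_mem (hother j (Finset.ne_of_mem_erase hj)) _
    have hq0 : q ≠ 0 := Finset.prod_ne_zero_iff.mpr fun j _ => pow_ne_zero _ (hx0 j)
    have hprod : ∏ j, x j ^ a j = x i ^ a i * q :=
      (Finset.mul_prod_erase Finset.univ (fun j => x j ^ a j) (Finset.mem_univ i)).symm
    set σ : ℤ := N' * m + a i with hσ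
    set U := u ^ N * v ^ a i * q with hU
    have hUO : U ∈ O := mul_mem (mul_mem (pow_mem hu _) (pow_mem hv _)) hqO
    have hUi : U⁻¹ ∈ O := by
      rw [hU, mul_inv, mul_inv, ← inv_pow, ← inv_pow]
      exact mul_mem (mul_mem (pow_mem hui _) (pow_mem hvi _)) hqi
    have hU0 : U ≠ 0 := mul_ne_zero (mul_ne_zero (pow_ne_zero _ hu0) (pow_ne_zero _ hv0)) hq0
    have hcx : c ^ N * ∏ j, x j ^ a j = U * π ^ ((e : ℤ) * σ) := by
      have e1 : (e : ℤ) * σ = m * N + (e * a i : ℕ) := by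
        rw [hσ, hN']; push_cast; ring
      rw [hprod, e1, zpow_add₀ hp, zpow_mul, zpow_natCast, zpow_natCast, hxe, hU, hcu]
      ring
    rw [hcx] at hc
    have hs0 := S.zpow_nonneg hU0 hUi hc
    have hσ0 : 0 ≤ σ := by
      by_contra! hlt
      have : (e : ℤ) * σ < 0 := mul_neg_of_pos_of_neg (by positivity) hlt
      omega
    have hy : (N * D i c + a i * c / x i) * x i = c * (σ + N' * μ) := by
      have hxi0 := hx0 i
      rw [hμd, hl, D_eq_ldv, hσ, hN']
      push_cast
      field_simp
      ring
    have key : (N * D i c + a i * c / x i) ^ N * x i ^ (N - 1) * ∏ j, x j ^ a j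
        = U * v⁻¹ * (π ^ ((e : ℤ) * σ - e) * (σ + N' * μ) ^ N) := by
      have hxi0 := hx0 i
      apply mul_right_cancel₀ hxi0
      have : x i ^ (N - 1) * x i = x i ^ N := by
        rw [← pow_succ]; congr 1; omega
      calc _ = ((N * D i c + a i * c / x i) * x i) ^ N * ∏ j, x j ^ a j := by
            rw [mul_pow, ← this]; ring
        _ = (U * π ^ ((e : ℤ) * σ)) * (σ + N' * μ) ^ N := by rw [hy, mul_pow, ← hcx]; ring
        _ = _ := by
            rw [hxe, zpow_sub₀ hp, zpow_natCast]
            field_simp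
    rw [key]
    refine mul_mem (mul_mem hUO hvi) ?_
    have hμO := S.mId_le hμ
    rcases eq_or_lt_of_le hσ0 with h0 | hpos
    · rw [← h0]
      have hle : e ≤ N := Nat.le_of_dvd (Nat.pos_of_ne_zero hN) ⟨N', hN'⟩
      have e2 : π ^ ((e : ℤ) * 0 - e) * (((0 : ℤ) : L) + N' * μ) ^ N
          = N' ^ N * (π⁻¹ * μ) ^ N * π ^ (N - e) := by
        have h5 : π ^ N = π ^ (N - e) * π ^ e := by rw [← pow_add]; congr 1; omega
        rw [mul_zero, zero_sub, zpow_neg, zpow_natCast, Int.cast_zero, zero_add, mul_pow, mul_pow,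
          inv_pow, h5]
        field_simp
      rw [e2]
      exact mul_mem (mul_mem (pow_mem (natCast_mem _ _) _) (pow_mem (mem_mId.mp hμ) _)) (pow_mem S.mem _)
    · refine mul_mem (S.zpow_mem ?_) (pow_mem (add_mem (intCast_mem _ _)
        (mul_mem (natCast_mem _ _) hμO)) _)
      nlinarith [show (0:ℤ) < e by positivity]

end DVRPart
end ModP1

section ModP2a
open Polynomial

section CoreLemma

variable {B L : Type} [CommRing B] [IsDomain B] [Field L] [Algebra B L] [IsFractionRing B L]

/-- the localization at a prime as a subring of the fraction field -/
noncomputable def OP (L : Type) [Field L] [Algebra B L] [IsFractionRing B L]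
    (P : Ideal B) [P.IsPrime] : Subring L :=
  (Localization.subalgebra.ofField L P.primeCompl P.primeCompl_le_nonZeroDivisors).toSubring

lemma mem_OP {P : Ideal B} [P.IsPrime] {z : L} :
    z ∈ OP L P ↔ ∃ a s : B, s ∉ P ∧ z = algebraMap B L a * (algebraMap B L s)⁻¹ := by
  change (∃ (a s : B) (_ : s ∈ P.primeCompl), _) ↔ _
  simp only [exists_prop]
  rfl

lemma OP_noeth [IsNoetherianRing B] (P : Ideal B) [P.IsPrime] : IsNoetherianRing (OP L P) := by
  have := IsLocalization.isNoetherianRing P.primeCompl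
    (Localization.subalgebra.ofField L P.primeCompl P.primeCompl_le_nonZeroDivisors) inferInstance
  exact this

lemma B_mem_OP (P : Ideal B) [P.IsPrime] (b : B) : algebraMap B L b ∈ OP L P :=
  mem_OP.mpr ⟨b, 1, fun h => Ideal.IsPrime.ne_top' (P.eq_top_of_isUnit_mem h isUnit_one), by simp⟩

lemma inv_mem_OP {P : Ideal B} [P.IsPrime] {b : B} (hb : b ∉ P) : (algebraMap B L b)⁻¹ ∈ OP L P :=
  mem_OP.mpr ⟨1, b, hb, by simp⟩

lemma aM_ne {b : B} (hb : b ≠ 0) : algebraMap B L b ≠ 0 :=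
  (map_ne_zero_iff _ (IsFractionRing.injective B L)).mpr hb

lemma inv_not_mem_OP {P : Ideal B} [P.IsPrime] {b : B} (hb : b ∈ P) (h0 : b ≠ 0) :
    (algebraMap B L b)⁻¹ ∉ OP L P := by
  intro h
  obtain ⟨a, s, hs, h⟩ := mem_OP.mp h
  have hs0 : s ≠ 0 := by rintro rfl; exact hs (zero_mem _)
  have h1 := aM_ne (L := L) hs0
  have h2 := aM_ne (L := L) h0
  apply hs
  have : s = a * b := by
    apply IsFractionRing.injective B L
    rw [map_mul]
    field_simp at h
    rw [h]; ring
  rw [this]; exact P.mul_mem_left _ hb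

lemma exists_height_one [IsNoetherianRing B] [IsIntegrallyClosed B] (f : L)
    (hf : f ∉ (algebraMap B L).range) :
    ∃ (P : Ideal B) (_ : P.IsPrime) (π : B), π ∈ P ∧ UData (OP L P) (algebraMap B L π) ∧
      f ∉ OP L P := by
  let R := LinearMap.range (Algebra.linearMap B L)
  have memR : ∀ g : L, g ∈ R ↔ ∃ b, algebraMap B L b = g := fun g => by simp [R]
  have hx : (Submodule.Quotient.mk f : L ⧸ R) ≠ 0 := by
    rw [Ne, Submodule.Quotient.mk_eq_zero, memR]
    exact fun h => hf h
  obtain ⟨P, hP, hle⟩ := exists_le_isAssociatedPrime_of_isNoetherianRing B _ hx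
  rw [isAssociatedPrime_iff] at hP
  obtain ⟨hPp, g, hg⟩ := hP
  obtain ⟨g, rfl⟩ := Submodule.Quotient.mk_surjective _ g
  have memc : ∀ (b : B) (g : L), b ∈ (⊥ : Submodule B (L ⧸ R)).colon {Submodule.Quotient.mk g} ↔
      ∃ c, algebraMap B L c = algebraMap B L b * g := by
    intro b g
    rw [Submodule.mem_colon_singleton, ← Submodule.Quotient.mk_smul, Submodule.mem_bot,
      Submodule.Quotient.mk_eq_zero, memR, Algebra.smul_def]
  have hPm : ∀ b, b ∈ P ↔ ∃ c, algebraMap B L c = algebraMap B L b * g := fun b => by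
    rw [hg]; exact memc b g
  have hfO : f ∉ OP L P := by
    intro h
    obtain ⟨a, s, hs, h⟩ := mem_OP.mp h
    have hs0 : s ≠ 0 := by rintro rfl; exact hs (zero_mem _)
    apply hs
    apply hle
    rw [memc]
    refine ⟨a, ?_⟩
    have := aM_ne (L := L) hs0
    rw [h]; field_simp
  by_cases hcase : ∃ p ∈ P, ∃ w, w ∉ P ∧ algebraMap B L w = algebraMap B L p * g
  · obtain ⟨p, hp, w, hw, hpw⟩ := hcase
    have hw0 : w ≠ 0 := by rintro rfl; exact hw (zero_mem _)
    have hw1 := aM_ne (L := L) hw0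
    have hp1 : algebraMap B L p ≠ 0 := by
      intro h; rw [h, zero_mul] at hpw; exact hw1 hpw
    have hp0 : p ≠ 0 := by rintro rfl; simp at hp1
    have hdiv : ∀ z ∈ P, (algebraMap B L p)⁻¹ * algebraMap B L z ∈ OP L P := by
      intro z hz
      obtain ⟨c, hc⟩ := (hPm z).mp hz
      refine mem_OP.mpr ⟨c, w, hw, ?_⟩
      rw [hc, hpw]
      have hg0 : g ≠ 0 := by rintro rfl; simp [hw1] at hpw
      field_simp
    have := OP_noeth (L := L) P
    have hfacB : ∀ b : B, b ≠ 0 → ∃ u ∈ OP L P, u⁻¹ ∈ OP L P ∧ ∃ m : ℤ,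
        algebraMap B L b = u * (algebraMap B L p) ^ m := by
      intro b hb
      let p' : OP L P := ⟨algebraMap B L p, B_mem_OP P p⟩
      let b' : OP L P := ⟨algebraMap B L b, B_mem_OP P b⟩
      have hp' : ¬ IsUnit p' := by
        intro h
        obtain ⟨q, hq⟩ := h.exists_right_inv
        apply inv_not_mem_OP (L := L) hp hp0
        have : algebraMap B L p * (q : L) = 1 := congrArg Subtype.val hq
        rw [← eq_inv_of_mul_eq_one_right this]; exact q.2
      have hb' : b' ≠ 0 := fun h => aM_ne (L := L) hb (congrArg Subtype.val h)
      obtain ⟨c, hc, hnd⟩ :=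
        (FiniteMultiplicity.of_not_isUnit hp' hb').exists_eq_pow_mul_and_not_dvd
      refine ⟨c, c.2, ?_, multiplicity p' b', ?_⟩
      · obtain ⟨a, s, hs, h⟩ := mem_OP.mp c.2
        by_cases ha : a ∈ P
        · exfalso
          apply hnd
          refine ⟨⟨(algebraMap B L p)⁻¹ * algebraMap B L a * (algebraMap B L s)⁻¹,
            mul_mem (hdiv a ha) (inv_mem_OP hs)⟩, ?_⟩
          apply Subtype.ext
          change (c : L) = algebraMap B L p * _
          rw [h]; simp only; field_simp
        · rw [h]
          exact mem_OP.mpr ⟨s, a, ha, by simp [mul_comm]⟩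
      · have : algebraMap B L b = (algebraMap B L p) ^ (multiplicity p' b') * (c : L) :=
          congrArg Subtype.val hc
        rw [this, zpow_natCast, mul_comm]
    refine ⟨P, hPp, p, hp, ⟨B_mem_OP P p, inv_not_mem_OP hp hp0, ?_⟩, hfO⟩
    intro c hc
    obtain ⟨a, s, hs, rfl⟩ := IsFractionRing.div_surjective B c
    have hs0 : s ≠ 0 := nonZeroDivisors.ne_zero hs
    have ha0 : a ≠ 0 := by rintro rfl; simp at hc
    obtain ⟨u, hu, hui, m, h1⟩ := hfacB a ha0
    obtain ⟨v, hv, hvi, l, h2⟩ := hfacB s hs0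
    refine ⟨u * v⁻¹, mul_mem hu hvi, by rw [mul_inv, inv_inv]; exact mul_mem hui hv, m - l, ?_⟩
    rw [h1, h2, zpow_sub₀ hp1]
    rw [div_eq_mul_inv, div_eq_mul_inv, mul_inv]; ring
  · exfalso
    push Not at hcase
    have hint : _root_.IsIntegral B g := by
      refine isIntegral_of_smul_mem_submodule (A := L) (M := L)
        (Submodule.map (Algebra.linearMap B L) P) ?_ ?_ g ?_
      · obtain ⟨a, s, hs, rfl⟩ := IsFractionRing.div_surjective B g
        have hs0 : s ≠ 0 := nonZeroDivisors.ne_zero hs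
        rw [Submodule.ne_bot_iff]
        have := aM_ne (L := L) hs0
        refine ⟨algebraMap B L s, ⟨s, (hPm s).mpr ⟨a, by field_simp⟩, rfl⟩, this⟩
      · exact (IsNoetherian.noetherian P).map _
      · rintro _ ⟨z, hz, rfl⟩
        obtain ⟨c, hc⟩ := (hPm z).mp hz
        refine ⟨c, ?_, ?_⟩
        · by_contra hcP; exact hcase z hz c hcP hc
        · simp [hc, mul_comm]
    obtain ⟨y, hy⟩ := IsIntegrallyClosed.algebraMap_eq_of_integral hint
    apply hPp.ne_top
    rw [Ideal.eq_top_iff_one, hPm]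
    exact ⟨y, by simp [hy]⟩

end CoreLemma
end ModP2a

section ModP2b
open Polynomial

section CoreLemma2

variable {A B L : Type} [CommRing A] [CommRing B] [IsDomain B] [Field L] [Algebra B L]
  [IsFractionRing B L] [Algebra A B] [Algebra A L] [IsScalarTower A B L]

lemma UData.div_of_mem {P : Ideal B} [P.IsPrime] {π : L} (h : UData (OP L P) π)
    {z : B} (hz : z ∈ P) : π⁻¹ * algebraMap B L z ∈ OP L P := by
  by_cases h0 : z = 0
  · simp [h0, zero_mem]
  obtain ⟨v, hv, hvi, e, he, hx⟩ := (h.cases (B_mem_OP P z) (aM_ne h0)).resolve_left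
    (inv_not_mem_OP hz h0)
  obtain ⟨e', rfl⟩ := Nat.exists_eq_succ_of_ne_zero he
  rw [hx]
  have := mul_mem hv (pow_mem h.mem e')
  have hp := h.ne_zero
  convert this using 1
  field_simp
  rw [pow_succ]; ring

lemma exists_res [Module.Finite A B] (P : Ideal B) [P.IsPrime]
    (hQ : ∀ n : ℕ, n ≠ 0 → IsUnit (n : B)) (b : B) :
    ∃ f : A[X], aeval b f ∈ P ∧ aeval b (derivative f) ∉ P := by
  classical
  let φ : A →+* B ⧸ P := (Ideal.Quotient.mk P).comp (algebraMap A B)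
  have key : ∀ f : A[X], aeval b f ∈ P ↔ eval₂ φ (Ideal.Quotient.mk P b) f = 0 := by
    intro f
    rw [← Ideal.Quotient.eq_zero_iff_mem, aeval_def, hom_eval₂]
  have hex : ∃ d : ℕ, ∃ f : A[X], f.natDegree = d ∧ f.map φ ≠ 0 ∧ aeval b f ∈ P := by
    obtain ⟨f, hf, hfb⟩ := Algebra.IsIntegral.isIntegral (R := A) b
    refine ⟨_, f, rfl, (hf.map φ).ne_zero, ?_⟩
    rw [aeval_def, hfb]; exact zero_mem _
  obtain ⟨f, hfd, hf0, hfb⟩ := Nat.find_spec hex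
  refine ⟨f, hfb, fun hd => ?_⟩
  have hdeg : f.natDegree ≠ 0 := by
    intro h0
    rw [eq_C_of_natDegree_eq_zero h0] at hfb hf0
    rw [key, eval₂_C] at hfb
    rw [map_C, hfb] at hf0
    simp at hf0
  have hlt := natDegree_derivative_lt hdeg
  have hdm : (derivative f).map φ = 0 := by
    by_contra hne
    rw [hfd] at hlt
    exact Nat.find_min hex hlt ⟨_, rfl, hne, hd⟩
  have hc : ∀ n, φ (f.coeff (n + 1)) = 0 := by
    intro n
    have h1 := congrArg (fun g => g.coeff n) hdm
    simp only [coeff_map, coeff_derivative, map_mul, coeff_zero] at h1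
    refine (mul_eq_zero.mp h1).resolve_right ?_
    have := (hQ (n + 1) (by omega)).map (Ideal.Quotient.mk P)
    have h2 : φ ((n : A) + 1) = Ideal.Quotient.mk P ((n + 1 : ℕ) : B) := by simp [φ]
    rw [h2]; exact this.ne_zero
  have hfc : f.map φ = C (φ (f.coeff 0)) := by
    ext n
    cases n with
    | zero => simp
    | succ n => rw [coeff_map, hc, coeff_C_succ]
  rw [key, ← Polynomial.eval_map, hfc, Polynomial.eval_C] at hfb
  rw [hfc, hfb] at hf0
  simp at hf0

lemma dvrSetup [Module.Finite A B] (P : Ideal B) [P.IsPrime]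
    (hQ : ∀ n : ℕ, n ≠ 0 → IsUnit (n : B)) (π : L) (hU : UData (OP L P) π) :
    DVRSetup (OP L P) (algebraMap A L).range (algebraMap B L).range π where
  toUData := hU
  natInv n hn := by
    have : (n : B) ∉ P := fun h => Ideal.IsPrime.ne_top' (P.eq_top_of_isUnit_mem h (hQ n hn))
    simpa using inv_mem_OP (L := L) this
  natNe n hn := by
    have := aM_ne (L := L) (hQ n hn).ne_zero
    simpa using this
  A_le := by
    rintro _ ⟨a, rfl⟩
    rw [IsScalarTower.algebraMap_apply A B L]
    exact B_mem_OP P _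
  B_le := by rintro _ ⟨b, rfl⟩; exact B_mem_OP P _
  units u hu hui hu0 := by
    obtain ⟨a, s, hs, h⟩ := mem_OP.mp hu
    have hs0 : s ≠ 0 := by rintro rfl; exact hs (zero_mem _)
    have ha0 : a ≠ 0 := by rintro rfl; simp [h] at hu0
    refine ⟨_, ⟨a, rfl⟩, _, ⟨s, rfl⟩, aM_ne ha0, aM_ne hs0, by rw [h, div_eq_mul_inv], ?_, inv_mem_OP hs⟩
    by_contra hcon
    have haP : a ∈ P := by by_contra h; exact hcon (inv_mem_OP h)
    apply inv_not_mem_OP (L := L) haP ha0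
    have := mul_mem hui (inv_mem_OP (L := L) hs)
    have h1 := aM_ne (L := L) hs0
    have h2 := aM_ne (L := L) ha0
    convert this using 1
    rw [h]; field_simp
  res b hb := by
    obtain ⟨b, rfl⟩ := hb
    obtain ⟨f, hf, hf'⟩ := exists_res (A := A) P hQ b
    refine ⟨f.map (algebraMap A L), fun n => ⟨f.coeff n, by simp⟩, ?_, ?_, ?_⟩
    · rw [Polynomial.eval_map, ← aeval_def, aeval_algebraMap_apply]
      exact hU.div_of_mem hf
    · rw [derivative_map, Polynomial.eval_map, ← aeval_def, aeval_algebraMap_apply]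
      exact aM_ne (by rintro h; rw [h] at hf'; exact hf' (zero_mem _))
    · rw [derivative_map, Polynomial.eval_map, ← aeval_def, aeval_algebraMap_apply]
      exact inv_mem_OP hf'

lemma minimal_of_UData {P : Ideal B} [hP : P.IsPrime] {π : L} (h : UData (OP L P) π) {X : B}
    (hX0 : X ≠ 0) (hX : X ∈ P) : P ∈ (Ideal.span {X}).minimalPrimes := by
  refine ⟨⟨hP, (Ideal.span_singleton_le_iff_mem _).mpr hX⟩, ?_⟩
  rintro Q ⟨hQ, hXQ⟩ hQP b hb
  rw [Ideal.span_singleton_le_iff_mem] at hXQ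
  by_cases hb0 : b = 0
  · rw [hb0]; exact zero_mem _
  obtain ⟨v, hv, hvi, e, he, hx⟩ := (h.cases (B_mem_OP P X) (aM_ne hX0)).resolve_left
    (inv_not_mem_OP hX hX0)
  obtain ⟨u, hu, hui, m, hm, hbm⟩ := (h.cases (B_mem_OP P b) (aM_ne hb0)).resolve_left
    (inv_not_mem_OP hb hb0)
  obtain ⟨a, s, hs, hw⟩ := mem_OP.mp (mul_mem (pow_mem hu e) (pow_mem hvi m))
  have hs0 : s ≠ 0 := by rintro rfl; exact hs (zero_mem _)
  have hv0 : v ≠ 0 := by rintro rfl; exact aM_ne (L := L) hX0 (by simp [hx])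
  have : s * b ^ e = a * X ^ m := by
    apply IsFractionRing.injective B L
    simp only [map_mul, map_pow]
    have h1 := aM_ne (L := L) hs0
    rw [hx, hbm]
    have h2 : algebraMap B L a = u ^ e * v⁻¹ ^ m * algebraMap B L s := by
      rw [hw]; field_simp
    rw [h2, mul_pow, mul_pow, ← pow_mul, ← pow_mul, mul_comm m e, inv_pow]
    field_simp
  have hmem : s * b ^ e ∈ Q := by
    rw [this]; exact Q.mul_mem_left _ (Ideal.pow_mem_of_mem _ hXQ _ (Nat.pos_of_ne_zero hm))
  exact hQ.mem_of_pow_mem _ ((hQ.mem_or_mem hmem).resolve_left fun h => hs (hQP h))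

lemma exists_K [Module.Finite A B] {k : Type} [CommRing k] [Algebra k L] (X : B)
    (D : Derivation k L L) (hDA : ∀ a : A, D (algebraMap A L a) ∈ (algebraMap A L).range)
    (hst : ∀ b : B, ∃ K : ℕ, algebraMap B L X ^ K * D (algebraMap B L b) ∈ (algebraMap B L).range) :
    ∃ K : ℕ, ∀ b : B, algebraMap B L X ^ K * D (algebraMap B L b) ∈ (algebraMap B L).range := by
  classical
  choose K hK using hst
  obtain ⟨s, hs⟩ := Module.Finite.fg_top (R := A) (M := B)
  have hX : algebraMap B L X ∈ (algebraMap B L).range := ⟨X, rfl⟩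
  refine ⟨s.sup K, fun b => ?_⟩
  have hb : b ∈ Submodule.span A (s : Set B) := by rw [hs]; trivial
  induction hb using Submodule.span_induction with
  | mem g hg =>
    have hle : K g ≤ s.sup K := Finset.le_sup hg
    obtain ⟨d, hd⟩ := Nat.exists_eq_add_of_le hle
    rw [hd, pow_add, mul_comm (_ ^ K g), mul_assoc]
    exact mul_mem (pow_mem hX _) (hK g)
  | zero => simp [zero_mem]
  | add x y _ _ hx hy => rw [map_add, map_add, mul_add]; exact add_mem hx hy
  | smul a x _ hx =>
    have e1 : algebraMap B L (a • x) = algebraMap A L a * algebraMap B L x := by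
      rw [Algebra.smul_def, map_mul, ← IsScalarTower.algebraMap_apply]
    have hAB : (algebraMap A L).range ≤ (algebraMap B L).range := by
      rintro _ ⟨a, rfl⟩
      exact ⟨algebraMap A B a, by rw [← IsScalarTower.algebraMap_apply]⟩
    rw [e1, D.leibniz, mul_add, smul_eq_mul, smul_eq_mul]
    refine add_mem ?_ (mul_mem (pow_mem hX _) (mul_mem ⟨x, rfl⟩ (hAB (hDA a))))
    have := mul_mem (hAB ⟨a, rfl⟩) hx
    convert this using 1; ring

lemma core_lemma [Module.Finite A B] [IsNoetherianRing B] [IsIntegrallyClosed B]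
    {k : Type} [CommRing k] [Algebra k L]
    (hQ : ∀ n : ℕ, n ≠ 0 → IsUnit (n : B)) {n : ℕ} (x : Fin n → A)
    (hx0 : ∀ j, algebraMap A L (x j) ≠ 0) (D : Fin n → Derivation k L L)
    (hDA : ∀ i (a : A), D i (algebraMap A L a) ∈ (algebraMap A L).range)
    (hDx : ∀ i j, D i (algebraMap A L (x j)) = if i = j then 1 else 0)
    (hst : ∀ i (b : B), ∃ K : ℕ, algebraMap B L (∏ j, algebraMap A B (x j)) ^ K *
      D i (algebraMap B L b) ∈ (algebraMap B L).range) :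
    ∃ N : ℕ, N ≠ 0 ∧ ∀ (i : Fin n) (c : L) (a : Fin n → ℕ),
      c ^ N * ∏ j, algebraMap A L (x j) ^ a j ∈ (algebraMap B L).range →
      (N * D i c + a i * c / algebraMap A L (x i)) ^ N * algebraMap A L (x i) ^ (N - 1) *
        ∏ j, algebraMap A L (x j) ^ a j ∈ (algebraMap B L).range := by
  classical
  set X : B := ∏ j, algebraMap A B (x j) with hXdef
  have hXL : algebraMap B L X = ∏ j, algebraMap A L (x j) := by
    rw [hXdef, map_prod]; simp only [← IsScalarTower.algebraMap_apply]
  have hX0 : X ≠ 0 := by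
    intro h
    rw [h, map_zero] at hXL
    exact Finset.prod_ne_zero_iff.mpr (fun j _ => hx0 j) hXL.symm
  let S : Set (Ideal B) := (Ideal.span {X}).minimalPrimes
  have hS : S.Finite := Ideal.finite_minimalPrimes_of_isNoetherianRing B _
  -- a fixed uniformizer
  let good : Ideal B → Prop := fun P => ∃ (_ : P.IsPrime) (π : B), UData (OP L P) (algebraMap B L π)
  let ϖ : Ideal B → B := fun P => if h : good P then h.choose_spec.choose else 0
  have hϖ : ∀ (P : Ideal B) (_ : P.IsPrime), good P → UData (OP L P) (algebraMap B L (ϖ P)) := by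
    intro P hP h
    simp only [ϖ, dif_pos h]
    exact h.choose_spec.choose_spec
  have hE : ∀ (P : Ideal B) (j : Fin n), ∃ E : ℕ, E ≠ 0 ∧ ∀ (hP : P.IsPrime), good P →
      ∀ v ∈ OP L P, v⁻¹ ∈ OP L P → ∀ e : ℕ, e ≠ 0 →
        algebraMap A L (x j) = v * algebraMap B L (ϖ P) ^ e → e ∣ E := by
    intro P j
    by_cases h : ∃ (_ : P.IsPrime), good P ∧ ∃ v ∈ OP L P, v⁻¹ ∈ OP L P ∧ ∃ e : ℕ, e ≠ 0 ∧
        algebraMap A L (x j) = v * algebraMap B L (ϖ P) ^ e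
    · obtain ⟨hP, hg, v, hv, hvi, e, he, hx⟩ := h
      refine ⟨e, he, fun _ _ v' hv' hvi' e' he' hx' => ?_⟩
      have hU := hϖ P hP hg
      have hp := hU.ne_zero
      have hv0 : v ≠ 0 := by rintro rfl; exact hx0 j (by simp [hx])
      have hv0' : v' ≠ 0 := by rintro rfl; exact hx0 j (by simp [hx'])
      have aux : ∀ (w w' : L) (d d' : ℕ), w ≠ 0 → w' ≠ 0 → w ∈ OP L P → w' ∈ OP L P →
          w'⁻¹ ∈ OP L P → w⁻¹ ∈ OP L P →
          w * algebraMap B L (ϖ P) ^ d = w' * algebraMap B L (ϖ P) ^ d' → d ≤ d' := by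
        intro w w' d d' h0 h0' hw hw' hwi' hwi heq
        have := hU.zpow_nonneg (U := w⁻¹ * w') (s := (d' : ℤ) - d)
          (mul_ne_zero (inv_ne_zero h0) h0')
          (by rw [mul_inv, inv_inv]; exact mul_mem hw hwi') (by
            rw [zpow_sub₀ hp, zpow_natCast, zpow_natCast]
            have : w⁻¹ * w' * (algebraMap B L (ϖ P) ^ d' / algebraMap B L (ϖ P) ^ d) = 1 := by
              field_simp
              rw [← heq]
            rw [this]; exact one_mem _)
        omega
      have h1 := aux v v' e e' hv0 hv0' hv hv' hvi' hvi (hx.symm.trans hx')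
      have h2 := aux v' v e' e hv0' hv0 hv' hv hvi hvi' (hx'.symm.trans hx)
      rw [le_antisymm h1 h2]
    · refine ⟨1, one_ne_zero, fun hP hg v hv hvi e he hx => (h ?_).elim⟩
      exact ⟨hP, hg, v, hv, hvi, e, he, hx⟩
  choose E hE0 hE using hE
  have hN0 : (∏ P ∈ hS.toFinset, ∏ j, E P j) ≠ 0 :=
    Finset.prod_ne_zero_iff.mpr fun P _ => Finset.prod_ne_zero_iff.mpr fun j _ => hE0 P j
  refine ⟨∏ P ∈ hS.toFinset, ∏ j, E P j, hN0, ?_⟩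
  set N := ∏ P ∈ hS.toFinset, ∏ j, E P j with hN
  intro i c a hc
  by_contra hcon
  obtain ⟨P, hP, π', -, hU', hnot⟩ := exists_height_one _ hcon
  have hg : good P := ⟨hP, π', hU'⟩
  have hU := hϖ P hP hg
  set π := algebraMap B L (ϖ P) with hπ
  have T := dvrSetup (A := A) P hQ π hU
  apply hnot
  have hp := hU.ne_zero
  refine T.final (fun j => algebraMap A L (x j)) (fun j => ⟨x j, rfl⟩) hx0 D ?_ hDx ?_ ?_ N hN0 ?_
    i c a (T.B_le hc)
  · rintro i _ ⟨a, rfl⟩; exact hDA i a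
  · intro i
    obtain ⟨K, hK⟩ := exists_K X (D i) (hDA i) (hst i)
    obtain ⟨v, hv, hvi, e, hXe⟩ : ∃ v ∈ OP L P, v⁻¹ ∈ OP L P ∧ ∃ e : ℕ,
        algebraMap B L X = v * π ^ e := by
      rcases hU.cases (B_mem_OP P X) (aM_ne hX0) with h | ⟨v, hv, hvi, e, -, h⟩
      · exact ⟨_, B_mem_OP P X, h, 0, by simp⟩
      · exact ⟨v, hv, hvi, e, h⟩
    have hv0 : v ≠ 0 := by rintro rfl; exact aM_ne (L := L) hX0 (by simp [hXe])
    have hDb : ∀ b : B, π ^ (e * K) * D i (algebraMap B L b) ∈ OP L P := by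
      intro b
      have := mul_mem (pow_mem hvi K) (T.B_le (hK b))
      convert this using 1
      rw [hXe, mul_pow, ← pow_mul, inv_pow]; field_simp
    refine ⟨e * K + 1, fun c => ?_⟩
    by_cases hc0 : c = 0
    · rw [hc0, ldv_zero, mul_zero]; exact zero_mem _
    obtain ⟨u, hu, hui, m, hcu⟩ := hU.fac c hc0
    have hu0 : u ≠ 0 := by rintro rfl; simp [hcu] at hc0
    obtain ⟨_, ⟨b, rfl⟩, _, ⟨s, rfl⟩, hb0, hs0, hbs, hbi, hsi⟩ := T.units u hu hui hu0
    rw [hcu, ldv_mul _ hu0 (zpow_ne_zero _ hp), ldv_zpow _ hp, mul_add]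
    refine add_mem ?_ ?_
    · rw [hbs, div_eq_mul_inv, ldv_mul _ hb0 (inv_ne_zero hs0), ldv_inv _ hs0]
      have h1 := mul_mem hU.mem (sub_mem (mul_mem (hDb b) hbi) (mul_mem (hDb s) hsi))
      convert h1 using 1
      simp only [ldv]; rw [pow_succ]; ring
    · have h1 := mul_mem (intCast_mem _ m) (hDb (ϖ P))
      convert h1 using 1
      simp only [ldv]; rw [pow_succ, ← hπ]; field_simp
  · intro hxi i c hc
    obtain ⟨K, hK⟩ := exists_K X (D i) (hDA i) (hst i)
    have hXi : (algebraMap B L X)⁻¹ ∈ OP L P := by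
      rw [hXL, ← Finset.prod_inv_distrib]; exact prod_mem fun j _ => hxi j
    have hDb : ∀ b : B, D i (algebraMap B L b) ∈ OP L P := by
      intro b
      have := mul_mem (pow_mem hXi K) (T.B_le (hK b))
      convert this using 1
      have := aM_ne (L := L) hX0
      rw [inv_pow]
      field_simp
    obtain ⟨b, s, hs, rfl⟩ := mem_OP.mp hc
    have hs0 : s ≠ 0 := by rintro rfl; exact hs (zero_mem _)
    have hs1 := aM_ne (L := L) hs0
    have hsi := inv_mem_OP (L := L) hs
    rw [D_eq_ldv]
    by_cases hb0 : b = 0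
    · simp [hb0, zero_mem]
    have hb1 := aM_ne (L := L) hb0
    rw [ldv_mul _ hb1 (inv_ne_zero hs1), ldv_inv _ hs1]
    have h1 := mul_mem hsi (sub_mem (hDb b)
      (mul_mem (mul_mem (B_mem_OP (L := L) P b) hsi) (hDb s)))
    convert h1 using 1
    simp only [ldv]; field_simp; ring
  · intro j v hv hvi e he hx
    refine (hE P j hP hg v hv hvi e he hx).trans ?_
    by_cases hXP : X ∈ P
    · have hPS : P ∈ hS.toFinset := by
        rw [Set.Finite.mem_toFinset]; exact minimal_of_UData hU hX0 hXP
      exact (Finset.dvd_prod_of_mem (fun j => E P j) (Finset.mem_univ j)).trans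
        (Finset.dvd_prod_of_mem (fun P => ∏ j, E P j) hPS)
    · exfalso
      have hxj : algebraMap A B (x j) ∉ P := fun h =>
        hXP (P.mem_of_dvd (Finset.dvd_prod_of_mem _ (Finset.mem_univ j)) h)
      have h1 := inv_mem_OP (L := L) hxj
      rw [← IsScalarTower.algebraMap_apply, hx] at h1
      apply hU.inv_not_mem
      obtain ⟨e', rfl⟩ := Nat.exists_eq_succ_of_ne_zero he
      have hv0 : v ≠ 0 := by rintro rfl; exact hx0 j (by simp [hx])
      have h2 := mul_mem (mul_mem h1 hv) (pow_mem hU.mem e')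
      convert h2 using 1
      rw [pow_succ]; field_simp

end CoreLemma2
end ModP2b

section ModP3a
section LiftDer
open scoped KaehlerDifferential TensorProduct

variable {k P E : Type} [CommRing k] [CommRing P] [CommRing E] [Algebra k P] [Algebra k E]
  [Algebra P E] [IsScalarTower k P E]

lemma exists_lift_der [Algebra.FormallyEtale P E] (d : Derivation k P P) :
    ∃ D : Derivation k E E, ∀ p, D (algebraMap P E p) = algebraMap P E (d p) := by
  let e := KaehlerDifferential.tensorKaehlerEquivOfFormallyEtale k P E
  let d' : Derivation k P E := (Algebra.linearMap P E).compDer d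
  let l : E ⊗[P] Ω[P⁄k] →ₗ[E] E :=
    (LinearMap.liftBaseChangeEquiv E) d'.liftKaehlerDifferential
  refine ⟨(l ∘ₗ e.symm.toLinearMap).compDer (KaehlerDifferential.D k E), fun p => ?_⟩
  have h : e (1 ⊗ₜ KaehlerDifferential.D k P p) = KaehlerDifferential.D k E (algebraMap P E p) := by
    simp [e]
  change l (e.symm (KaehlerDifferential.D k E (algebraMap P E p))) = _
  rw [← h, LinearEquiv.symm_apply_apply]
  simp [l, d']

lemma der_unique [Algebra.FormallyUnramified P E] {M : Type} [AddCommGroup M] [Module E M]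
    [Module k M] [IsScalarTower k E M] (d₁ d₂ : Derivation k E M)
    (h : ∀ p, d₁ (algebraMap P E p) = d₂ (algebraMap P E p)) : d₁ = d₂ := by
  letI : Module P M := Module.compHom M (algebraMap P E)
  haveI : IsScalarTower P E M := ⟨fun a r x => by rw [Algebra.smul_def, mul_smul]; rfl⟩
  let δ : Derivation P E M := Derivation.mk'
    { toFun := fun s => (d₁ - d₂) s
      map_add' := fun x y => map_add _ _ _
      map_smul' := fun a s => by
        rw [Algebra.smul_def, Derivation.leibniz, RingHom.id_apply, ← algebraMap_smul E a ((d₁ - d₂) s)]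
        simp [h] }
    (fun a b => (d₁ - d₂).leibniz a b)
  have h0 : ∀ s, δ s = 0 := by
    intro s
    rw [← Derivation.liftKaehlerDifferential_comp_D,
      Subsingleton.elim (KaehlerDifferential.D P E s) 0, map_zero]
  ext s
  exact sub_eq_zero.mp (h0 s)

end LiftDer
end ModP3a

section ModP3b
section Kummer

/-- the Kummer group -/
abbrev KG (n N : ℕ) : Type := Fin n → rootsOfUnity N ℂ

noncomputable instance KG_fintype (n N : ℕ) [NeZero N] : Fintype (KG n N) := Fintype.ofFinite _

/-- characters of the Kummer group -/
noncomputable def kchi {n N : ℕ} (a : Fin n → ℤ) : KG n N →* ℂ where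
  toFun g := ∏ i, (((g i : ℂˣ) ^ a i : ℂˣ) : ℂ)
  map_one' := by simp
  map_mul' g h := by
    rw [← Finset.prod_mul_distrib]
    refine Finset.prod_congr rfl fun i _ => ?_
    rw [Pi.mul_apply, Subgroup.coe_mul, mul_zpow, Units.val_mul]

lemma kchi_add {n N : ℕ} (a b : Fin n → ℤ) (g : KG n N) :
    kchi (a + b) g = kchi a g * kchi b g := by
  simp only [kchi, MonoidHom.coe_mk, OneHom.coe_mk]
  rw [← Finset.prod_mul_distrib]
  refine Finset.prod_congr rfl fun i _ => ?_
  rw [Pi.add_apply, zpow_add, Units.val_mul]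

lemma kchi_nat {n N : ℕ} (a : Fin n → ℕ) (g : KG n N) :
    kchi (fun i => (a i : ℤ)) g = ∏ i, ((g i : ℂˣ) : ℂ) ^ a i := by
  simp [kchi]

lemma kchi_sum {n N : ℕ} [NeZero N] (a b : Fin n → Fin N) (hab : a ≠ b) :
    ∑ g : KG n N, kchi (fun i => ((a i : ℕ) : ℤ) - ((b i : ℕ) : ℤ)) g = 0 := by
  apply sum_hom_units_eq_zero
  intro h
  obtain ⟨i, hi⟩ := Function.ne_iff.mp hab
  have hζ := Complex.isPrimitiveRoot_exp N (NeZero.ne N)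
  obtain ⟨u, hu⟩ := hζ.isUnit (NeZero.ne N)
  have huζ : IsPrimitiveRoot u N := by
    rw [← hu] at hζ; exact (IsPrimitiveRoot.coe_units_iff).mp hζ
  let ζ : rootsOfUnity N ℂ := ⟨u, by rw [mem_rootsOfUnity]; exact huζ.pow_eq_one⟩
  have h1 := congrArg (fun f => f (Function.update 1 i ζ)) h
  simp only [kchi, MonoidHom.coe_mk, OneHom.coe_mk, MonoidHom.one_apply] at h1
  rw [Finset.prod_eq_single i] at h1
  · rw [Function.update_self, Units.val_eq_one, huζ.zpow_eq_one_iff_dvd] at h1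
    apply hi
    apply Fin.ext
    have h2 := (a i).isLt
    have h3 := (b i).isLt
    have h4 := Int.eq_zero_of_abs_lt_dvd h1 (by rw [abs_lt]; omega)
    omega
  · intro j _ hj
    simp [Function.update_of_ne hj]
  · simp

variable {B C C' : Type} [CommRing B] [CommRing C] [CommRing C'] [Algebra B C] [Algebra C C']
  [Algebra B C'] [IsScalarTower B C C'] [Algebra ℂ B] [Algebra ℂ C] [Algebra ℂ C']
  [IsScalarTower ℂ B C] [IsScalarTower ℂ C C'] [IsScalarTower ℂ B C'] {n N : ℕ} [NeZero N]

structure KSetup (x : Fin n → B) (t : Fin n → C') (ρ : KG n N → C' →+* C') : Prop where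
  t_pow : ∀ i, t i ^ N = algebraMap B C' (x i)
  inj : Function.Injective (algebraMap C C')
  span : ∀ z : C', ∃ c : (Fin n → Fin N) → C, z = ∑ a, algebraMap C C' (c a) * ∏ i, t i ^ (a i : ℕ)
  ρ_C : ∀ g c, ρ g (algebraMap C C' c) = algebraMap C C' c
  ρ_t : ∀ g i, ρ g (t i) = algebraMap ℂ C' ((g i : ℂˣ) : ℂ) * t i
  ρ_one : ρ 1 = RingHom.id C'
  ρ_mul : ∀ g h, ρ (g * h) = (ρ g).comp (ρ h)

namespace KSetup
variable {x : Fin n → B} {t : Fin n → C'} {ρ : KG n N → C' →+* C'}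

include C in
lemma ρ_alg (S : KSetup (C := C) x t ρ) (g : KG n N) (b : B) :
    ρ g (algebraMap B C' b) = algebraMap B C' b := by
  rw [IsScalarTower.algebraMap_apply B C C', S.ρ_C]

include C in
lemma ρ_int (S : KSetup (C := C) x t ρ) (g : KG n N) {z : C'} (hz : _root_.IsIntegral B z) :
    _root_.IsIntegral B (ρ g z) := by
  let φ : C' →ₐ[B] C' := { ρ g with commutes' := S.ρ_alg g }
  exact hz.map φ

lemma component (S : KSetup (C := C) x t ρ) (c : (Fin n → Fin N) → C) (b : Fin n → Fin N) :
    algebraMap C C' (c b) * ∏ i, t i ^ (b i : ℕ) =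
      algebraMap ℂ C' (Fintype.card (KG n N) : ℂ)⁻¹ * ∑ g : KG n N,
        algebraMap ℂ C' (kchi (fun i => -((b i : ℕ) : ℤ)) g) *
          ρ g (∑ a, algebraMap C C' (c a) * ∏ i, t i ^ (a i : ℕ)) := by
  have h1 : ∀ g : KG n N, algebraMap ℂ C' (kchi (fun i => -((b i : ℕ) : ℤ)) g) *
          ρ g (∑ a, algebraMap C C' (c a) * ∏ i, t i ^ (a i : ℕ)) =
      ∑ a : Fin n → Fin N, algebraMap ℂ C' (kchi (fun i => ((a i : ℕ) : ℤ) - ((b i : ℕ) : ℤ)) g) *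
        (algebraMap C C' (c a) * ∏ i, t i ^ (a i : ℕ)) := by
    intro g
    rw [map_sum, Finset.mul_sum]
    refine Finset.sum_congr rfl fun a _ => ?_
    have e1 : (fun i => ((a i : ℕ) : ℤ) - ((b i : ℕ) : ℤ))
      = (fun i => ((a i : ℕ) : ℤ)) + (fun i => -((b i : ℕ) : ℤ)) := by
      ext i; simp [sub_eq_add_neg]
    rw [e1, kchi_add, kchi_nat, map_mul, map_mul, S.ρ_C, map_prod, map_prod]
    simp only [map_pow, S.ρ_t, mul_pow, Finset.prod_mul_distrib]
    ring
  simp only [h1]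
  rw [Finset.sum_comm]
  simp only [← Finset.sum_mul, ← map_sum]
  rw [Finset.sum_eq_single b]
  · have : ∑ g : KG n N, kchi (fun i => ((b i : ℕ) : ℤ) - ((b i : ℕ) : ℤ)) g
      = (Fintype.card (KG n N) : ℂ) := by
      simp [kchi]
    rw [this, ← mul_assoc, ← map_mul, inv_mul_cancel₀, map_one, one_mul]
    exact Nat.cast_ne_zero.mpr Fintype.card_ne_zero
  · intro a _ hab
    rw [kchi_sum a b hab, map_zero, zero_mul]
  · simp

lemma component_int (S : KSetup (C := C) x t ρ) (c : (Fin n → Fin N) → C)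
    (hz : _root_.IsIntegral B (∑ a, algebraMap C C' (c a) * ∏ i, t i ^ (a i : ℕ))) (b : Fin n → Fin N) :
    _root_.IsIntegral B (algebraMap C C' (c b) * ∏ i, t i ^ (b i : ℕ)) := by
  have hC : ∀ w : ℂ, _root_.IsIntegral B (algebraMap ℂ C' w) := fun w => by
    rw [IsScalarTower.algebraMap_apply ℂ B C']; exact isIntegral_algebraMap
  rw [S.component]
  exact (hC _).mul (IsIntegral.sum _ fun g _ => (hC _).mul (S.ρ_int g hz))

lemma fixed (S : KSetup (C := C) x t ρ) (z : C') (hz : ∀ g, ρ g z = z) : ∃ c, algebraMap C C' c = z := by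
  obtain ⟨c, hc⟩ := S.span z
  have := S.component c 0
  rw [← hc] at this
  simp only [hz, Fin.coe_ofNat_eq_mod, Nat.zero_mod, Pi.zero_apply] at this
  refine ⟨c 0, ?_⟩
  have e : ∀ g : KG n N, kchi (fun _ => -((0 : ℕ) : ℤ)) g = 1 := fun g => by simp [kchi]
  simp only [e, map_one, one_mul, Finset.sum_const, Finset.card_univ, nsmul_eq_mul, pow_zero,
    Finset.prod_const_one, mul_one] at this
  rw [this, ← mul_assoc]
  have h2 : ((Fintype.card (KG n N) : ℕ) : C') = algebraMap ℂ C' (Fintype.card (KG n N) : ℂ) := by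
    simp
  rw [h2, ← map_mul, inv_mul_cancel₀, map_one, one_mul]
  exact Nat.cast_ne_zero.mpr Fintype.card_ne_zero

include C in
lemma mon_pow (S : KSetup (C := C) x t ρ) (a : Fin n → ℕ) :
    (∏ i, t i ^ a i) ^ N = algebraMap B C' (∏ i, x i ^ a i) := by
  rw [← Finset.prod_pow, map_prod]
  refine Finset.prod_congr rfl fun i _ => ?_
  rw [← pow_mul, mul_comm, pow_mul, S.t_pow, map_pow]

include C in
lemma t_int (S : KSetup (C := C) x t ρ) (i : Fin n) : _root_.IsIntegral B (t i) := by
  apply IsIntegral.of_pow (Nat.pos_of_ne_zero (NeZero.ne N))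
  rw [S.t_pow]; exact isIntegral_algebraMap

lemma int_C (S : KSetup (C := C) x t ρ) (hBC : ∀ c : C, _root_.IsIntegral B c → c ∈ (algebraMap B C).range)
    (c : C) (h : _root_.IsIntegral B (algebraMap C C' c)) : c ∈ (algebraMap B C).range :=
  hBC c ((isIntegral_algebraMap_iff S.inj).mp h)

lemma mon_int (S : KSetup (C := C) x t ρ) (hBC : ∀ c : C, _root_.IsIntegral B c → c ∈ (algebraMap B C).range)
    (c : C) (a : Fin n → ℕ) :
    _root_.IsIntegral B (algebraMap C C' c * ∏ i, t i ^ a i) ↔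
      c ^ N * ∏ i, algebraMap B C (x i) ^ a i ∈ (algebraMap B C).range := by
  have e : (algebraMap C C' c * ∏ i, t i ^ a i) ^ N
      = algebraMap C C' (c ^ N * ∏ i, algebraMap B C (x i) ^ a i) := by
    rw [mul_pow, S.mon_pow, map_mul, map_pow, IsScalarTower.algebraMap_apply B C C', map_prod]
    simp only [map_pow]
  constructor
  · intro h
    apply S.int_C hBC
    rw [← e]; exact h.pow N
  · rintro ⟨b, hb⟩
    apply IsIntegral.of_pow (Nat.pos_of_ne_zero (NeZero.ne N))
    rw [e, ← hb, ← IsScalarTower.algebraMap_apply]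
    exact isIntegral_algebraMap

lemma X_mul (S : KSetup (C := C) x t ρ) (hBC : ∀ c : C, _root_.IsIntegral B c → c ∈ (algebraMap B C).range)
    (c : C) (a : Fin n → Fin N) (h : _root_.IsIntegral B (algebraMap C C' c * ∏ i, t i ^ (a i : ℕ))) :
    algebraMap B C (∏ i, x i) * c ∈ (algebraMap B C).range := by
  rw [S.mon_int hBC] at h
  obtain ⟨b, hb⟩ := h
  apply hBC
  apply IsIntegral.of_pow (Nat.pos_of_ne_zero (NeZero.ne N))
  have : (algebraMap B C (∏ i, x i) * c) ^ N
      = algebraMap B C (b * ∏ i, x i ^ (N - a i)) := by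
    rw [map_mul, hb, mul_pow, ← map_pow, ← Finset.prod_pow, map_prod, map_prod, mul_assoc,
      ← Finset.prod_mul_distrib, mul_comm]
    congr 1
    refine Finset.prod_congr rfl fun i _ => ?_
    rw [map_pow, map_pow, ← pow_add]
    congr 1
    have := (a i).isLt
    omega
  rw [this]; exact isIntegral_algebraMap

lemma finite (S : KSetup (C := C) x t ρ) (hBC : ∀ c : C, _root_.IsIntegral B c → c ∈ (algebraMap B C).range)
    [IsNoetherianRing B] (hX : IsUnit (algebraMap B C (∏ i, x i))) :
    Module.Finite B (integralClosure B C') := by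
  let m : (Fin n → Fin N) → C' := fun a => ∏ i, t i ^ (a i : ℕ)
  let M : Submodule B C' := Submodule.span B (Set.range m)
  have : Module.Finite B M := Module.Finite.span_of_finite B (Set.finite_range m)
  have : IsNoetherian B M := isNoetherian_of_isNoetherianRing_of_finite B M
  have hmem : ∀ r : integralClosure B C', (∏ i, x i) • (r : C') ∈ M := by
    rintro ⟨z, hz⟩
    obtain ⟨c, hc⟩ := S.span z
    have hz' : _root_.IsIntegral B z := hz
    rw [hc] at hz'
    simp only
    rw [hc, Finset.smul_sum]
    refine sum_mem fun a _ => ?_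
    obtain ⟨b, hb⟩ := S.X_mul hBC _ a (S.component_int c hz' a)
    rw [Algebra.smul_def, ← mul_assoc, IsScalarTower.algebraMap_apply B C C', ← map_mul, ← hb,
      ← IsScalarTower.algebraMap_apply, ← Algebra.smul_def]
    exact M.smul_mem _ (Submodule.subset_span ⟨a, rfl⟩)
  let f : integralClosure B C' →ₗ[B] M :=
    { toFun := fun r => ⟨(∏ i, x i) • (r : C'), hmem r⟩
      map_add' := fun r s => by ext; simp
      map_smul' := fun b r => Subtype.ext (smul_comm _ b (r : C')) }
  have hf : Function.Injective f := by
    intro r s h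
    have h1 : (∏ i, x i) • (r : C') = (∏ i, x i) • (s : C') := congrArg Subtype.val h
    rw [Algebra.smul_def, Algebra.smul_def, IsScalarTower.algebraMap_apply B C C'] at h1
    exact Subtype.ext ((hX.map (algebraMap C C')).mul_left_cancel h1)
  exact Module.Finite.of_injective f hf

lemma isLocalization (S : KSetup (C := C) x t ρ) [IsLocalization.Away (∏ i, x i) C] :
    IsLocalization.Away (∏ i, (⟨t i, S.t_int i⟩ : integralClosure B C')) C' := by
  set T : integralClosure B C' := ∏ i, (⟨t i, S.t_int i⟩ : integralClosure B C')
  have hT : (T : C') = ∏ i, t i := by simp [T]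
  have hTN : (T : C') ^ N = algebraMap B C' (∏ i, x i) := by
    have := S.mon_pow (fun _ => 1)
    simpa [hT] using this
  have hXu : IsUnit (algebraMap B C (∏ i, x i)) := IsLocalization.Away.algebraMap_isUnit _
  have hTu : IsUnit (T : C') := by
    rw [← isUnit_pow_iff (NeZero.ne N), hTN, IsScalarTower.algebraMap_apply B C C']
    exact hXu.map _
  have hone : ∀ c : C, ∃ m : ℕ, _root_.IsIntegral B ((T : C') ^ m * algebraMap C C' c) := by
    intro c
    obtain ⟨m, b, hb⟩ := IsLocalization.Away.surj (∏ i, x i) c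
    refine ⟨N * m, ?_⟩
    rw [pow_mul, hTN, IsScalarTower.algebraMap_apply B C C', ← map_pow, ← map_mul, mul_comm, hb,
      ← IsScalarTower.algebraMap_apply]
    exact isIntegral_algebraMap
  refine ⟨?_, ?_, ?_⟩
  · rintro ⟨_, m, rfl⟩
    rw [map_pow]
    exact hTu.pow m
  · intro z
    obtain ⟨c, hc⟩ := S.span z
    choose m hm using fun a => hone (c a)
    let K := Finset.univ.sup m
    have hint : _root_.IsIntegral B ((T : C') ^ K * z) := by
      rw [hc, Finset.mul_sum]
      refine IsIntegral.sum _ fun a _ => ?_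
      have e : K = (K - m a) + m a := by
        have : m a ≤ K := Finset.le_sup (Finset.mem_univ a)
        omega
      rw [e, pow_add, ← mul_assoc, mul_assoc ((T : C') ^ (K - m a))]
      exact ((IsIntegral.pow T.2 _).mul (hm a)).mul (IsIntegral.prod _ fun i _ => (S.t_int i).pow _)
    refine ⟨⟨⟨_, hint⟩, ⟨T ^ K, K, rfl⟩⟩, ?_⟩
    change z * ((T ^ K : integralClosure B C') : C') = (T : C') ^ K * z
    rw [mul_comm]; simp
  · intro r s h
    exact ⟨1, by rw [Subtype.ext h]⟩

include C in
lemma der_mon (S : KSetup (C := C) x t ρ) (E : Derivation ℂ C' C') (i : Fin n)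
    (hE : ∀ j, E (t j) = if i = j then 1 else 0) (a : Fin n → ℕ) :
    E (∏ j, t j ^ a j) * t i = a i * ∏ j, t j ^ a j := by
  classical
  have key : ∀ s : Finset (Fin n), E (∏ j ∈ s, t j ^ a j) * t i
      = (if i ∈ s then (a i : C') else 0) * ∏ j ∈ s, t j ^ a j := by
    intro s
    induction s using Finset.induction_on with
    | empty => simp
    | insert j s hj ih =>
      rw [Finset.prod_insert hj, Derivation.leibniz, smul_eq_mul, smul_eq_mul, add_mul, mul_assoc,
        ih, Derivation.leibniz_pow, hE]
      by_cases hij : i = j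
      · subst hij
        simp only [if_neg hj, Finset.mem_insert_self, if_true, zero_mul, mul_zero, zero_add,
          smul_eq_mul, nsmul_eq_mul, mul_one]
        rcases Nat.eq_zero_or_pos (a i) with h0 | h0
        · simp [h0]
        · have : t i ^ (a i) = t i ^ (a i - 1) * t i := by rw [← pow_succ]; congr 1; omega
          rw [this]; ring
      · simp only [Finset.mem_insert, hij, false_or, if_false, smul_zero, mul_zero, zero_mul,
          add_zero]
        ring
  simpa using key Finset.univ

lemma der_stable (S : KSetup (C := C) x t ρ) (hBC : ∀ c : C, _root_.IsIntegral B c → c ∈ (algebraMap B C).range)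
    (i : Fin n) (xi : C) (hxi : algebraMap B C (x i) * xi = 1)
    (D : Derivation ℂ C C) (E : Derivation ℂ C' C')
    (hED : ∀ c, E (algebraMap C C' c) = N * t i ^ (N - 1) * algebraMap C C' (D c))
    (hE : ∀ j, E (t j) = if i = j then 1 else 0)
    (hcore : ∀ (c : C) (a : Fin n → ℕ), c ^ N * ∏ j, algebraMap B C (x j) ^ a j ∈ (algebraMap B C).range →
      (N * D c + a i * c * xi) ^ N * algebraMap B C (x i) ^ (N - 1) *
        ∏ j, algebraMap B C (x j) ^ a j ∈ (algebraMap B C).range)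
    (z : C') (hz : _root_.IsIntegral B z) : _root_.IsIntegral B (E z) := by
  classical
  obtain ⟨c, hc⟩ := S.span z
  rw [hc] at hz ⊢
  rw [map_sum]
  refine IsIntegral.sum _ fun a _ => ?_
  have h1 := S.component_int c hz a
  rw [S.mon_int hBC] at h1
  have h2 := hcore _ _ h1
  have hti : algebraMap C C' xi * t i ^ (N - 1) * t i = 1 := by
    rw [mul_assoc, ← pow_succ, Nat.sub_add_cancel (Nat.pos_of_ne_zero (NeZero.ne N)), S.t_pow,
      IsScalarTower.algebraMap_apply B C C', ← map_mul, mul_comm, hxi, map_one]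
  have hmon : E (∏ j, t j ^ (a j : ℕ))
      = (a i : ℕ) * algebraMap C C' xi * t i ^ (N - 1) * ∏ j, t j ^ (a j : ℕ) := by
    have h3 := S.der_mon E i hE (fun j => (a j : ℕ))
    calc E (∏ j, t j ^ (a j : ℕ))
        = E (∏ j, t j ^ (a j : ℕ)) * t i * (algebraMap C C' xi * t i ^ (N - 1)) := by
          rw [mul_assoc, mul_comm (t i), hti, mul_one]
      _ = _ := by rw [h3]; ring
  have e : E (algebraMap C C' (c a) * ∏ j, t j ^ (a j : ℕ))
      = algebraMap C C' (N * D (c a) + (a i : ℕ) * c a * xi) *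
        ∏ j, t j ^ ((a j : ℕ) + if j = i then N - 1 else 0) := by
    rw [Derivation.leibniz, hED, hmon]
    simp only [pow_add, Finset.prod_mul_distrib]
    have : ∏ j, t j ^ (if j = i then N - 1 else 0) = t i ^ (N - 1) := by
      rw [Finset.prod_eq_single i] <;> simp +contextual
    rw [this]
    simp only [smul_eq_mul, map_add, map_mul, map_natCast]
    ring
  rw [e, S.mon_int hBC]
  convert h2 using 1
  rw [Finset.prod_congr rfl fun j _ => pow_add (algebraMap B C (x j)) _ _,
    Finset.prod_mul_distrib]
  have : ∏ j, algebraMap B C (x j) ^ (if j = i then N - 1 else 0) = algebraMap B C (x i) ^ (N - 1) := by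
    rw [Finset.prod_eq_single i] <;> simp +contextual
  rw [this]; ring

end KSetup
end Kummer
end ModP3b

section ModP3c
section KummerPoly
open MvPolynomial

/-- the Kummer cover of affine space -/
def KP (n _N : ℕ) : Type := MvPolynomial (Fin n) ℂ

namespace KP
variable {n N : ℕ}

noncomputable instance : CommRing (KP n N) := inferInstanceAs (CommRing (MvPolynomial (Fin n) ℂ))
noncomputable instance : Algebra ℂ (KP n N) := inferInstanceAs (Algebra ℂ (MvPolynomial (Fin n) ℂ))
instance : IsNoetherianRing (KP n N) :=
  inferInstanceAs (IsNoetherianRing (MvPolynomial (Fin n) ℂ))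
instance : Algebra.Smooth ℂ (KP n N) :=
  have : Algebra.Smooth ℂ (MvPolynomial (Fin n) ℂ) := ⟨inferInstance, inferInstance⟩
  this

/-- the structure map -/
noncomputable def str (n N : ℕ) : MvPolynomial (Fin n) ℂ →ₐ[ℂ] KP n N :=
  (MvPolynomial.expand N : MvPolynomial (Fin n) ℂ →ₐ[ℂ] MvPolynomial (Fin n) ℂ)

noncomputable instance : Algebra (MvPolynomial (Fin n) ℂ) (KP n N) := (str n N).toRingHom.toAlgebra

lemma algebraMap_eq (p : MvPolynomial (Fin n) ℂ) :
    algebraMap (MvPolynomial (Fin n) ℂ) (KP n N) p = str n N p := rfl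

instance : IsScalarTower ℂ (MvPolynomial (Fin n) ℂ) (KP n N) :=
  IsScalarTower.of_algebraMap_eq fun c => by
    rw [algebraMap_eq]; exact ((str n N).commutes c).symm

/-- coordinates -/
noncomputable def t (i : Fin n) : KP n N := (X i : MvPolynomial (Fin n) ℂ)

lemma t_pow (i : Fin n) : (t i : KP n N) ^ N = algebraMap (MvPolynomial (Fin n) ℂ) (KP n N) (X i) :=
  (MvPolynomial.expand_X N i).symm

lemma inj [NeZero N] : Function.Injective (algebraMap (MvPolynomial (Fin n) ℂ) (KP n N)) :=
  MvPolynomial.expand_injective (NeZero.pos N)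

lemma span [NeZero N] (z : KP n N) : ∃ c : (Fin n → Fin N) → MvPolynomial (Fin n) ℂ,
    z = ∑ a, algebraMap _ (KP n N) (c a) * ∏ i, t i ^ (a i : ℕ) := by
  classical
  let M := Submodule.span (MvPolynomial (Fin n) ℂ)
    (Set.range fun a : Fin n → Fin N => (∏ i, t i ^ (a i : ℕ) : KP n N))
  have hmon : ∀ u : Fin n → ℕ, (∏ i, t i ^ u i : KP n N) ∈ M := by
    intro u
    have : (∏ i, t i ^ u i : KP n N) = (∏ i, (X i : MvPolynomial (Fin n) ℂ) ^ (u i / N)) •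
        ∏ i, t i ^ ((⟨u i % N, Nat.mod_lt _ (NeZero.pos N)⟩ : Fin N) : ℕ) := by
      rw [Algebra.smul_def, map_prod, ← Finset.prod_mul_distrib]
      refine Finset.prod_congr rfl fun i _ => ?_
      rw [map_pow, ← t_pow, ← pow_mul, ← pow_add, Nat.div_add_mod]
    rw [this]
    exact M.smul_mem _ (Submodule.subset_span
      ⟨fun i => ⟨u i % N, Nat.mod_lt _ (NeZero.pos N)⟩, rfl⟩)
  have key : ∀ z : MvPolynomial (Fin n) ℂ, (z : KP n N) ∈ M := by
    intro z
    induction z using MvPolynomial.induction_on' with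
    | monomial u a =>
      have : (monomial u a : MvPolynomial (Fin n) ℂ) =
        (C a : MvPolynomial (Fin n) ℂ) * ∏ i, (X i : MvPolynomial (Fin n) ℂ) ^ u i := by
        rw [monomial_eq, Finsupp.prod_fintype]; simp
      rw [this]
      have h2 := M.smul_mem (C a) (hmon u)
      rw [Algebra.smul_def, algebraMap_eq] at h2
      have h3 : str n N (C a) = (C a : MvPolynomial (Fin n) ℂ) := MvPolynomial.expand_C N a
      rw [h3] at h2
      exact h2
    | add p q hp hq => exact M.add_mem hp hq
  have hz : z ∈ M := key z
  obtain ⟨c, hc⟩ := (Submodule.mem_span_range_iff_exists_fun _).mp hz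
  refine ⟨c, ?_⟩
  rw [← hc]
  simp only [Algebra.smul_def]

/-- the derivations -/
noncomputable def der (i : Fin n) : Derivation ℂ (KP n N) (KP n N) :=
  (MvPolynomial.pderiv i : Derivation ℂ (MvPolynomial (Fin n) ℂ) (MvPolynomial (Fin n) ℂ))

lemma der_t (i j : Fin n) : der i (t j : KP n N) = if i = j then 1 else 0 := by
  split_ifs with h
  · subst h; exact MvPolynomial.pderiv_X_self i
  · exact MvPolynomial.pderiv_X_of_ne (Ne.symm h)

lemma der_alg (i : Fin n) (p : MvPolynomial (Fin n) ℂ) :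
    der i (algebraMap _ (KP n N) p) =
      (N : KP n N) * t i ^ (N - 1) * algebraMap _ (KP n N) (pderiv i p) := by
  induction p using MvPolynomial.induction_on with
  | C a =>
    have : algebraMap (MvPolynomial (Fin n) ℂ) (KP n N) (C a) = algebraMap ℂ (KP n N) a :=
      (IsScalarTower.algebraMap_apply ℂ (MvPolynomial (Fin n) ℂ) (KP n N) a).symm
    rw [this]; simp
  | add p q hp hq => rw [map_add, map_add, hp, hq, map_add, map_add]; ring
  | mul_X p j hp =>
    rw [map_mul, Derivation.leibniz, hp, Derivation.leibniz, ← t_pow, Derivation.leibniz_pow, der_t]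
    simp only [smul_eq_mul, nsmul_eq_mul, map_add, map_mul, ← t_pow]
    by_cases h : i = j
    · subst h
      simp; ring
    · rw [if_neg h, MvPolynomial.pderiv_X_of_ne (Ne.symm h)]
      simp; ring

/-- the group action -/
noncomputable def σ (g : KG n N) : KP n N →ₐ[MvPolynomial (Fin n) ℂ] KP n N :=
  { (MvPolynomial.aeval (fun i => algebraMap ℂ (KP n N) ((g i : ℂˣ) : ℂ) * t i) :
      MvPolynomial (Fin n) ℂ →ₐ[ℂ] KP n N) with
    commutes' := by
      intro p
      change MvPolynomial.aeval _ (MvPolynomial.expand N p) = str n N p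
      induction p using MvPolynomial.induction_on with
      | C a => rw [MvPolynomial.expand_C, MvPolynomial.aeval_C]; exact ((str n N).commutes a).symm
      | add p q hp hq => rw [map_add, map_add, hp, hq, map_add]
      | mul_X p j hp =>
        rw [map_mul, map_mul, hp, map_mul, MvPolynomial.expand_X, map_pow, MvPolynomial.aeval_X,
          mul_pow, ← map_pow, ← Units.val_pow_eq_pow_val, ← Subgroup.coe_pow]
        have : ((g j : ℂˣ) ^ N) = 1 := (mem_rootsOfUnity N _).mp (g j).2
        rw [Subgroup.coe_pow, this, t_pow]
        simp [algebraMap_eq] }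

lemma σ_t (g : KG n N) (i : Fin n) :
    σ g (t i) = algebraMap ℂ (KP n N) ((g i : ℂˣ) : ℂ) * t i :=
  MvPolynomial.aeval_X _ i

lemma σ_C (g : KG n N) (c : ℂ) :
    σ g (algebraMap ℂ (KP n N) c) = algebraMap ℂ (KP n N) c :=
  MvPolynomial.aeval_C _ c

lemma hom_ext {R : Type*} [CommRing R] [Algebra ℂ R] {f g : KP n N →ₐ[ℂ] R}
    (h : ∀ i, f (t i) = g (t i)) : f = g :=
  MvPolynomial.algHom_ext (σ := Fin n) (R := ℂ) (A := R) (f := (f : MvPolynomial (Fin n) ℂ →ₐ[ℂ] R)) (g := (g : MvPolynomial (Fin n) ℂ →ₐ[ℂ] R)) h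

end KP
end KummerPoly
end ModP3c

section ModP4
section EtaleCriterion

/-- an ideal stable under the coordinate derivations and containing a monomial is everything -/
lemma ideal_eq_top_of_stable {k R : Type} [CommRing k] [CommRing R] [Algebra k R]
    (hQ : ∀ n : ℕ, n ≠ 0 → IsUnit (n : R)) {n : ℕ} (t : Fin n → R)
    (D : Fin n → Derivation k R R) (hD : ∀ i j, D i (t j) = if i = j then 1 else 0)
    (I : Ideal R) (hI : ∀ i, ∀ a ∈ I, D i a ∈ I) (K : ℕ) (hK : (∏ i, t i) ^ K ∈ I) : I = ⊤ := by
  classical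
  have key : ∀ (s : ℕ) (m : Fin n → ℕ), ∑ i, m i = s → ∏ i, t i ^ m i ∈ I → (1 : R) ∈ I := by
    intro s
    induction s with
    | zero =>
      intro m hm h
      have : ∀ i, m i = 0 := fun i => (Finset.sum_eq_zero_iff.mp hm) i (Finset.mem_univ i)
      simpa [this] using h
    | succ s ih =>
      intro m hm h
      obtain ⟨i, hi⟩ : ∃ i, m i ≠ 0 := by
        by_contra! hcon
        simp [hcon] at hm
      obtain ⟨e, he⟩ := Nat.exists_eq_succ_of_ne_zero hi
      have hprod : ∀ m' : Fin n → ℕ, ∏ j, t j ^ m' j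
          = t i ^ m' i * ∏ j ∈ Finset.univ.erase i, t j ^ m' j := fun m' =>
        (Finset.mul_prod_erase Finset.univ (fun j => t j ^ m' j) (Finset.mem_univ i)).symm
      have h1 : D i (∏ j ∈ Finset.univ.erase i, t j ^ m j) = 0 := by
        have : ∀ s : Finset (Fin n), i ∉ s → D i (∏ j ∈ s, t j ^ m j) = 0 := by
          intro s
          induction s using Finset.induction_on with
          | empty => simp
          | insert j s hj ihs =>
            intro hi
            rw [Finset.prod_insert hj, Derivation.leibniz, ihs (fun h => hi (Finset.mem_insert_of_mem h)),
              Derivation.leibniz_pow, hD, if_neg (by rintro rfl; exact hi (Finset.mem_insert_self _ _))]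
            simp
        exact this _ (Finset.notMem_erase i _)
      refine ih (Function.update m i e) ?_ ?_
      · have h2 := Finset.add_sum_erase Finset.univ m (Finset.mem_univ i)
        have h3 := Finset.add_sum_erase Finset.univ (Function.update m i e) (Finset.mem_univ i)
        have h4 : ∑ j ∈ Finset.univ.erase i, Function.update m i e j
            = ∑ j ∈ Finset.univ.erase i, m j :=
          Finset.sum_congr rfl fun j hj => Function.update_of_ne (Finset.ne_of_mem_erase hj) _ _
        rw [h4] at h3
        simp only [Function.update_self] at h3
        omega
      · have h2 := hI i _ h
        rw [hprod, Derivation.leibniz, h1, smul_zero, zero_add, Derivation.leibniz_pow, hD,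
          if_pos rfl, he] at h2
        rw [hprod]
        have h4 : ∏ j ∈ Finset.univ.erase i, t j ^ Function.update m i e j
            = ∏ j ∈ Finset.univ.erase i, t j ^ m j :=
          Finset.prod_congr rfl fun j hj => by
            rw [Function.update_of_ne (Finset.ne_of_mem_erase hj)]
        rw [h4, Function.update_self]
        obtain ⟨u, hu⟩ := hQ (e + 1) (by omega)
        have h5 := I.mul_mem_left (↑u⁻¹ : R) h2
        convert h5 using 1
        simp only [smul_eq_mul, nsmul_eq_mul, Nat.succ_eq_add_one, Nat.add_sub_cancel, mul_one]
        rw [← hu]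
        have := u.inv_mul
        linear_combination (-1 : R) * (t i ^ e * ∏ j ∈ Finset.univ.erase i, t j ^ m j) * this
  rw [Ideal.eq_top_iff_one]
  exact key _ (fun _ => K) rfl (by rwa [Finset.prod_pow])

/-- twisted module -/
structure Tw {k R : Type} [CommRing k] [CommRing R] [Algebra k R] (_E : Derivation k R R)
    (M : Type) where
  fst : M
  snd : M

namespace Tw
variable {k R M : Type} [CommRing k] [CommRing R] [Algebra k R] {E : Derivation k R R}
  [AddCommGroup M] [Module R M]

@[ext] lemma ext' {x y : Tw E M} (h1 : x.fst = y.fst) (h2 : x.snd = y.snd) : x = y := by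
  cases x; cases y; simp_all

instance : Zero (Tw E M) := ⟨⟨0, 0⟩⟩
instance : Add (Tw E M) := ⟨fun x y => ⟨x.fst + y.fst, x.snd + y.snd⟩⟩
instance : Neg (Tw E M) := ⟨fun x => ⟨-x.fst, -x.snd⟩⟩
instance : SMul R (Tw E M) := ⟨fun r x => ⟨r • x.fst, r • x.snd + E r • x.fst⟩⟩

@[simp] lemma zero_fst : (0 : Tw E M).fst = 0 := rfl
@[simp] lemma zero_snd : (0 : Tw E M).snd = 0 := rfl
@[simp] lemma add_fst (x y : Tw E M) : (x + y).fst = x.fst + y.fst := rfl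
@[simp] lemma add_snd (x y : Tw E M) : (x + y).snd = x.snd + y.snd := rfl
@[simp] lemma neg_fst (x : Tw E M) : (-x).fst = -x.fst := rfl
@[simp] lemma neg_snd (x : Tw E M) : (-x).snd = -x.snd := rfl
@[simp] lemma smul_fst (r : R) (x : Tw E M) : (r • x).fst = r • x.fst := rfl
@[simp] lemma smul_snd (r : R) (x : Tw E M) : (r • x).snd = r • x.snd + E r • x.fst := rfl

instance : AddCommGroup (Tw E M) where
  add_assoc x y z := by ext <;> simp [add_assoc]
  zero_add x := by ext <;> simp
  add_zero x := by ext <;> simp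
  add_comm x y := by ext <;> simp [add_comm]
  neg_add_cancel x := by ext <;> simp
  nsmul := nsmulRec
  zsmul := zsmulRec

instance : Module R (Tw E M) where
  one_smul x := by ext <;> simp
  mul_smul r s x := by
    ext
    · simp [mul_smul]
    · simp only [smul_snd, Derivation.leibniz, smul_fst, smul_eq_mul, add_smul, mul_smul, smul_add]
      rw [smul_comm s (E r)]
      abel
  smul_zero r := by ext <;> simp
  smul_add r x y := by ext <;> simp [smul_add]; abel
  add_smul r s x := by ext <;> simp [add_smul]; abel
  zero_smul x := by ext <;> simp

end Tw

variable {k A R C : Type} [CommRing k] [CommRing A] [CommRing R] [CommRing C] [Algebra k A]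
  [Algebra k R] [Algebra A R] [Algebra R C] [Algebra A C]
  [IsScalarTower A R C]

open scoped KaehlerDifferential in
lemma kaehler_ann_stable (D : Derivation k A A) (E : Derivation k R R)
    (hE : ∀ a, E (algebraMap A R a) = algebraMap A R (D a))
    (r : R) (hr : ∀ ω : Ω[R⁄A], r • ω = 0) : ∀ ω : Ω[R⁄A], E r • ω = 0 := by
  letI : Module A (Tw E Ω[R⁄A]) := Module.compHom _ (algebraMap A R)
  haveI : IsScalarTower A R (Tw E Ω[R⁄A]) := ⟨fun a r x => by
    rw [Algebra.smul_def, mul_smul]; rfl⟩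
  let d := KaehlerDifferential.D A R
  let δ : Derivation A R (Tw E Ω[R⁄A]) := Derivation.mk'
    { toFun := fun s => ⟨d s, d (E s)⟩
      map_add' := fun x y => by ext <;> simp
      map_smul' := fun a s => by
        rw [Algebra.smul_def a s, RingHom.id_apply, ← algebraMap_smul R a (Tw.mk _ _ : Tw E Ω[R⁄A])]
        ext
        · rw [Tw.smul_fst, Derivation.leibniz, Derivation.map_algebraMap, smul_zero, add_zero]
        · simp only [RingHom.id_apply, Tw.smul_snd, Derivation.leibniz, map_add, smul_eq_mul, hE,
            Derivation.map_algebraMap, smul_zero, add_zero, d, zero_add] }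
    (fun a b => by
      ext
      · simp [d]
      · simp only [LinearMap.coe_mk, AddHom.coe_mk, Derivation.leibniz, map_add, smul_eq_mul,
          Tw.add_snd, Tw.smul_snd]
        abel)
  have hδ : ∀ s, r • δ s = 0 := by
    intro s
    have h := congrArg δ.liftKaehlerDifferential (hr (d s))
    rwa [map_smul, map_zero, Derivation.liftKaehlerDifferential_comp_D] at h
  intro ω
  have : ω ∈ Submodule.span R (Set.range d) := by
    rw [KaehlerDifferential.span_range_derivation]; trivial
  induction this using Submodule.span_induction with
  | mem x hx =>
    obtain ⟨s, rfl⟩ := hx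
    have h := congrArg Tw.snd (hδ s)
    have h2 : r • d (E s) + E r • d s = 0 := h
    rwa [hr, zero_add] at h2
  | zero => simp
  | add x y _ _ hx hy => rw [smul_add, hx, hy, add_zero]
  | smul a x _ hx => rw [smul_comm, hx, smul_zero]

open scoped KaehlerDifferential in
lemma unramified_of_derivations
    (hQ : ∀ n : ℕ, n ≠ 0 → IsUnit (n : R)) {n : ℕ} (t : Fin n → A)
    (D : Fin n → Derivation k A A) (E : Fin n → Derivation k R R)
    (hE : ∀ i a, E i (algebraMap A R a) = algebraMap A R (D i a))
    (hD : ∀ i j, D i (t j) = if i = j then 1 else 0)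
    [Module.Finite A R] [IsLocalization.Away (∏ i, algebraMap A R (t i)) C]
    [Algebra.FormallyUnramified A C] : Algebra.FormallyUnramified A R := by
  classical
  set T := ∏ i, algebraMap A R (t i)
  let I : Ideal R := Module.annihilator R Ω[R⁄A]
  have hloc := KaehlerDifferential.isLocalizedModule_map A R C (Submonoid.powers T)
  have h1 : ∀ ω : Ω[R⁄A], ∃ K : ℕ, T ^ K • ω = 0 := by
    intro ω
    obtain ⟨⟨_, K, rfl⟩, hs⟩ := (IsLocalizedModule.eq_zero_iff (Submonoid.powers T)
      (KaehlerDifferential.map A A R C)).mp (Subsingleton.elim (KaehlerDifferential.map A A R C ω) 0)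
    exact ⟨K, hs⟩
  choose K hK using h1
  obtain ⟨s, hs⟩ := Module.Finite.fg_top (R := R) (M := Ω[R⁄A])
  have hI : T ^ (s.sup K) ∈ I := by
    rw [Module.mem_annihilator]
    intro ω
    have hω : ω ∈ Submodule.span R (s : Set Ω[R⁄A]) := by rw [hs]; trivial
    induction hω using Submodule.span_induction with
    | mem x hx =>
      obtain ⟨d, hd⟩ := Nat.exists_eq_add_of_le (Finset.le_sup (f := K) hx)
      rw [hd, pow_add, mul_comm, mul_smul, hK, smul_zero]
    | zero => simp
    | add x y _ _ hx hy => rw [smul_add, hx, hy, add_zero]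
    | smul a x _ hx => rw [smul_comm, hx, smul_zero]
  have htop := ideal_eq_top_of_stable hQ (fun i => algebraMap A R (t i)) E
    (fun i j => by rw [hE, hD]; split_ifs <;> simp) I
    (fun i a ha => Module.mem_annihilator.mpr
      (kaehler_ann_stable (D i) (E i) (hE i) a (Module.mem_annihilator.mp ha))) _ hI
  rw [Module.annihilator_eq_top_iff] at htop
  exact ⟨htop⟩

lemma projective_of_derivations [IsNoetherianRing A]
    (hQ : ∀ n : ℕ, n ≠ 0 → IsUnit (n : A)) {n : ℕ} (t : Fin n → A)
    (D : Fin n → Derivation k A A) (E : Fin n → Derivation k R R)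
    (hE : ∀ i a, E i (algebraMap A R a) = algebraMap A R (D i a))
    (hD : ∀ i j, D i (t j) = if i = j then 1 else 0)
    [Module.Finite A R] [IsLocalization.Away (∏ i, algebraMap A R (t i)) C]
    (hinj : Function.Injective (algebraMap R C))
    [Module.Flat A C] : Module.Projective A R := by
  classical
  obtain ⟨m, q, hq⟩ := Module.Finite.exists_fin' A R
  let I : Ideal A :=
    { carrier := {a | ∃ h : R →ₗ[A] (Fin m → A), ∀ r, q (h r) = a • r}
      add_mem' := by
        rintro a b ⟨h, hh⟩ ⟨h', hh'⟩
        exact ⟨h + h', fun r => by simp [hh, hh', add_smul]⟩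
      zero_mem' := ⟨0, by simp⟩
      smul_mem' := by
        rintro c a ⟨h, hh⟩
        exact ⟨c • h, fun r => by simp [hh, mul_smul]⟩ }
  have hstab : ∀ i, ∀ a ∈ I, D i a ∈ I := by
    rintro i a ⟨h, hh⟩
    choose w hw using fun j => hq (E i (q (Pi.single j 1)))
    let W : (Fin m → A) →ₗ[A] (Fin m → A) := Fintype.linearCombination A w
    let N : (Fin m → A) → (Fin m → A) := fun v => (fun j => D i (v j)) + W v
    have hNs : ∀ (b : A) (v), N (b • v) = b • N v + D i b • v := by
      intro b v
      simp only [N]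
      ext j
      simp only [Pi.add_apply, Pi.smul_apply, map_smul, smul_eq_mul, Derivation.leibniz]
      ring
    have hNa : ∀ v v', N (v + v') = N v + N v' := by
      intro v v'
      simp only [N]
      ext j
      simp only [Pi.add_apply, map_add]
      ring
    have hEs : ∀ (b : A) (r : R), E i (b • r) = b • E i r + D i b • r := by
      intro b r
      simp only [Algebra.smul_def, Derivation.leibniz, hE, Algebra.algebraMap_self, RingHom.id_apply]
      ring
    have hqN : ∀ v, q (N v) = E i (q v) := by
      intro v
      have hv : v = ∑ j, v j • (Pi.single j 1 : Fin m → A) := by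
        ext l; simp [Finset.sum_apply, Pi.single_apply]
      simp only [N]
      have e1 : W v = ∑ j, v j • w j := by simp [W, Fintype.linearCombination_apply]
      have e2 : (fun j => D i (v j)) = ∑ j, D i (v j) • (Pi.single j 1 : Fin m → A) := by
        ext l; simp [Finset.sum_apply, Pi.single_apply]
      rw [e1, e2]
      conv_rhs => rw [hv]
      simp only [map_add, map_sum, map_smul, hw, hEs]
      rw [← Finset.sum_add_distrib]
      exact Finset.sum_congr rfl fun j _ => add_comm _ _
    refine ⟨{ toFun := fun r => N (h r) - h (E i r), map_add' := ?_, map_smul' := ?_ }, ?_⟩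
    · intro x y; simp only [map_add, hNa]; abel
    · intro b x; simp only [map_smul, hNs, hEs, map_add, RingHom.id_apply, smul_sub]; abel
    · intro r
      simp only [LinearMap.coe_mk, AddHom.coe_mk, map_sub, hqN, hh, hEs]
      abel
  set T := ∏ i, t i with hT
  set TR := ∏ i, algebraMap A R (t i) with hTR
  have hTT : algebraMap A R T = TR := by rw [hT, map_prod]
  have hpow : ∃ K, T ^ K ∈ I := by
    have : Module.FinitePresentation A R := Module.finitePresentation_of_finite A R
    obtain ⟨l, a, y, hya⟩ := Module.Flat.exists_factorization_of_finitePresentation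
      (IsScalarTower.toAlgHom A R C).toLinearMap
    have h1 : ∀ j : Fin l, ∃ K : ℕ, ∃ r : R,
        algebraMap R C r = algebraMap R C TR ^ K * y (Finsupp.single j 1) := by
      intro j
      obtain ⟨⟨r, ⟨_, K, rfl⟩⟩, hr⟩ := IsLocalization.surj (Submonoid.powers TR)
        (y (Finsupp.single j 1))
      exact ⟨K, r, by rw [← hr, ← map_pow, mul_comm]⟩
    choose K r hr using h1
    let Kt := Finset.univ.sup K
    choose v hv using fun j => hq (TR ^ (Kt - K j) * r j)
    let g : (Fin l →₀ A) →ₗ[A] (Fin m → A) := Finsupp.linearCombination A v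
    have hg : ∀ z, algebraMap R C (q (g z)) = algebraMap R C TR ^ Kt * y z := by
      intro z
      induction z using Finsupp.induction_linear with
      | zero => simp
      | add z z' h h' => simp only [map_add, h, h', mul_add]
      | single j b =>
        have e0 : (Finsupp.single j b : Fin l →₀ A) = b • Finsupp.single j 1 := by simp
        have e1 : g (Finsupp.single j 1) = v j := by simp [g]
        rw [e0, map_smul g, map_smul q, map_smul y, e1, hv, Algebra.smul_def, Algebra.smul_def,
          map_mul, ← IsScalarTower.algebraMap_apply, map_mul, map_pow, hr]
        have e2 : Kt = (Kt - K j) + K j := by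
          have : K j ≤ Kt := Finset.le_sup (Finset.mem_univ j)
          omega
        conv_rhs => rw [e2, pow_add]
        ring
    refine ⟨Kt, g ∘ₗ a, fun x => hinj ?_⟩
    rw [LinearMap.comp_apply, hg]
    have e3 : y (a x) = algebraMap R C x := by
      have := congrArg (fun f => f x) hya
      simpa using this.symm
    rw [e3, Algebra.smul_def, map_pow, hTT, map_mul, map_pow]
  obtain ⟨K, hK⟩ := hpow
  have htop := ideal_eq_top_of_stable hQ t D hD I hstab K hK
  obtain ⟨h, hh⟩ : (1 : A) ∈ I := by rw [htop]; trivial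
  exact Module.Projective.of_split h q (by ext r; simp [hh])

lemma etale_of_derivations [IsNoetherianRing A]
    (hQ : ∀ n : ℕ, n ≠ 0 → IsUnit (n : A)) {n : ℕ} (t : Fin n → A)
    (D : Fin n → Derivation k A A) (E : Fin n → Derivation k R R)
    (hE : ∀ i a, E i (algebraMap A R a) = algebraMap A R (D i a))
    (hD : ∀ i j, D i (t j) = if i = j then 1 else 0)
    [Module.Finite A R] [IsLocalization.Away (∏ i, algebraMap A R (t i)) C]
    (hinj : Function.Injective (algebraMap R C))
    [Module.Flat A C] [Algebra.FormallyUnramified A C] : Algebra.Etale A R := by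
  have := projective_of_derivations (C := C) hQ t D E hE hD hinj
  have := unramified_of_derivations (C := C) (fun n hn => by
    simpa using (hQ n hn).map (algebraMap A R)) t D E hE hD
  have : Algebra.FinitePresentation A R :=
    Algebra.FinitePresentation.of_finiteType.mp inferInstance
  exact Algebra.Etale.of_formallyUnramified_of_flat

end EtaleCriterion
end ModP4

section ModP5a
section Step
open MvPolynomial

variable {n : ℕ} {A B C : Type} [CommRing A] [CommRing B] [CommRing C]
  [Algebra (MvPolynomial (Fin n) ℂ) A] [Algebra A B] [Algebra B C] [Algebra A C]
  [IsScalarTower A B C] [Algebra ℂ A] [Algebra ℂ B] [Algebra ℂ C]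
  [IsScalarTower ℂ (MvPolynomial (Fin n) ℂ) A] [IsScalarTower ℂ A B] [IsScalarTower ℂ B C]
  [IsScalarTower ℂ A C]

lemma step_core [Algebra.Etale (MvPolynomial (Fin n) ℂ) A] [IsNoetherianRing B]
    [IsDomain B] [IsIntegrallyClosed B] [Module.Finite A B]
    (hX0 : ∏ j : Fin n, algebraMap A B (algebraMap (MvPolynomial (Fin n) ℂ) A (X j)) ≠ 0)
    [IsLocalization.Away
      (∏ j : Fin n, algebraMap A B (algebraMap (MvPolynomial (Fin n) ℂ) A (X j))) C]
    [Algebra.Etale A C] :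
    ∃ (N : ℕ) (D : Fin n → Derivation ℂ C C), N ≠ 0 ∧
      (∀ i p, D i (algebraMap A C (algebraMap (MvPolynomial (Fin n) ℂ) A p)) =
        algebraMap A C (algebraMap (MvPolynomial (Fin n) ℂ) A (pderiv i p))) ∧
      (∀ c : C, _root_.IsIntegral B c → c ∈ (algebraMap B C).range) ∧
      ∀ i (xi : C),
        algebraMap A C (algebraMap (MvPolynomial (Fin n) ℂ) A (X i)) * xi = 1 →
        ∀ (c : C) (a : Fin n → ℕ),
        c ^ N * ∏ j, algebraMap B C (algebraMap A B (algebraMap (MvPolynomial (Fin n) ℂ) A (X j))) ^ a j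
          ∈ (algebraMap B C).range →
        (N * D i c + a i * c * xi) ^ N *
          algebraMap B C (algebraMap A B (algebraMap (MvPolynomial (Fin n) ℂ) A (X i))) ^ (N - 1) *
          ∏ j, algebraMap B C (algebraMap A B (algebraMap (MvPolynomial (Fin n) ℂ) A (X j))) ^ a j
            ∈ (algebraMap B C).range := by
  set x : Fin n → A := fun j => algebraMap (MvPolynomial (Fin n) ℂ) A (X j) with hx
  set XX : B := ∏ j : Fin n, algebraMap A B (algebraMap (MvPolynomial (Fin n) ℂ) A (X j)) with hXX
  let L := FractionRing B
  have hM : Submonoid.powers XX ≤ nonZeroDivisors B :=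
    powers_le_nonZeroDivisors_of_noZeroDivisors hX0
  letI : Algebra C L := (IsLocalization.lift (M := Submonoid.powers XX) (S := C) (g := algebraMap B L)
    (fun y => IsLocalization.map_units L (⟨y, hM y.2⟩ : nonZeroDivisors B))).toAlgebra
  haveI t1 : IsScalarTower B C L := IsScalarTower.of_algebraMap_eq fun b =>
    (IsLocalization.lift_eq (M := Submonoid.powers XX) _ b).symm
  haveI t2 : IsScalarTower ℂ C L := IsScalarTower.of_algebraMap_eq fun w => by
    rw [IsScalarTower.algebraMap_apply ℂ B C, ← IsScalarTower.algebraMap_apply B C L,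
      IsScalarTower.algebraMap_apply ℂ B L]
  haveI t3 : IsScalarTower A C L := IsScalarTower.of_algebraMap_eq fun w => by
    rw [IsScalarTower.algebraMap_apply A B C, ← IsScalarTower.algebraMap_apply B C L,
      IsScalarTower.algebraMap_apply A B L]
  haveI : IsDomain C := IsLocalization.isDomain_of_le_nonZeroDivisors (M := Submonoid.powers XX) C hM
  haveI : IsFractionRing C L :=
    IsFractionRing.isFractionRing_of_isDomain_of_isLocalization (Submonoid.powers XX) C L
  haveI : Algebra.FormallyEtale C L := Algebra.FormallyEtale.of_isLocalization (nonZeroDivisors C)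
  have hinjCL : Function.Injective (algebraMap C L) := IsFractionRing.injective C L
  have hrange : ∀ c : C, algebraMap C L c ∈ (algebraMap B L).range ↔ c ∈ (algebraMap B C).range := by
    intro c
    constructor
    · rintro ⟨b, hb⟩
      exact ⟨b, hinjCL (by rw [← hb, IsScalarTower.algebraMap_apply B C L])⟩
    · rintro ⟨b, rfl⟩
      exact ⟨b, IsScalarTower.algebraMap_apply B C L b⟩
  choose DA hDA using fun i : Fin n => exists_lift_der (k := ℂ) (E := A) (pderiv (R := ℂ) i)
  choose DC hDC using fun i : Fin n => exists_lift_der (k := ℂ) (E := C) (DA i)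
  choose DL hDL using fun i : Fin n => exists_lift_der (k := ℂ) (E := L) (DC i)
  have hDLA : ∀ i a, DL i (algebraMap A L a) = algebraMap A L (DA i a) := fun i a => by
    rw [IsScalarTower.algebraMap_apply A C L, hDL, hDC, ← IsScalarTower.algebraMap_apply]
  obtain ⟨N, hN, hcore⟩ := core_lemma (A := A) (B := B) (L := L) (k := ℂ)
    (fun m hm => by
      have : IsUnit (algebraMap ℂ B m) := (IsUnit.mk0 (m : ℂ) (Nat.cast_ne_zero.mpr hm)).map _
      simpa using this) x
    (fun j h => by
      rw [IsScalarTower.algebraMap_apply A B L] at h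
      exact Finset.prod_ne_zero_iff.mp hX0 j (Finset.mem_univ j)
        ((IsFractionRing.injective B L) (by rw [h, map_zero])))
    DL (fun i a => ⟨_, (hDLA i a).symm⟩)
    (fun i j => by
      rw [hDLA, hx]
      simp only
      rw [hDA]
      split_ifs with h
      · subst h; simp
      · rw [pderiv_X_of_ne (Ne.symm h)]; simp)
    (fun i b => by
      rw [IsScalarTower.algebraMap_apply B C L b, hDL]
      obtain ⟨K, b', hb'⟩ := IsLocalization.Away.surj XX (DC i (algebraMap B C b))
      refine ⟨K, b', ?_⟩
      rw [IsScalarTower.algebraMap_apply B C L, ← hb', map_mul, mul_comm, map_pow,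
        ← IsScalarTower.algebraMap_apply B C L])
  refine ⟨N, DC, hN, fun i p => by rw [hDC, hDA], ?_, ?_⟩
  · intro c hc
    rw [← hrange]
    have : _root_.IsIntegral B (algebraMap C L c) := hc.map (IsScalarTower.toAlgHom B C L)
    obtain ⟨b, hb⟩ := IsIntegrallyClosed.algebraMap_eq_of_integral this
    exact ⟨b, hb⟩
  · intro i xi hxi c a h
    have e : ∀ j, algebraMap C L (algebraMap B C (algebraMap A B (x j))) = algebraMap A L (x j) := by
      intro j
      rw [← IsScalarTower.algebraMap_apply B C L, ← IsScalarTower.algebraMap_apply A B L]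
    have hxi' : algebraMap C L xi = (algebraMap A L (x i))⁻¹ := by
      apply eq_inv_of_mul_eq_one_right
      rw [IsScalarTower.algebraMap_apply A C L, ← map_mul]
      exact (congrArg _ hxi).trans (map_one _)
    have h1 := hcore i (algebraMap C L c) a (by
      rw [← hrange] at h
      simpa only [map_mul, map_pow, map_prod, e, x] using h)
    rw [← hrange]
    simp only [map_mul, map_pow, map_prod, map_add, map_natCast, hxi', ← hDL]
    simpa only [← e, div_eq_mul_inv] using h1

end Step
end ModP5a

section ModP5b
section Step
open MvPolynomial

variable {n N : ℕ} [NeZero N] {A B C A' C' : Type} [CommRing A] [CommRing B] [CommRing C]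
  [CommRing A'] [CommRing C']
  [Algebra (MvPolynomial (Fin n) ℂ) A] [Algebra A B] [Algebra B C] [Algebra A C]
  [IsScalarTower A B C] [Algebra ℂ A] [Algebra ℂ B] [Algebra ℂ C]
  [IsScalarTower ℂ (MvPolynomial (Fin n) ℂ) A] [IsScalarTower ℂ A B] [IsScalarTower ℂ B C]
  [IsScalarTower ℂ A C]
  [Algebra (KP n N) A'] [Algebra (KP n N) C'] [Algebra A' C'] [IsScalarTower (KP n N) A' C']
  [Algebra A A'] [Algebra A C'] [IsScalarTower A A' C'] [Algebra C C'] [IsScalarTower A C C']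
  [Algebra B C'] [IsScalarTower B C C'] [IsScalarTower A B C']
  [Algebra ℂ A'] [Algebra ℂ C'] [IsScalarTower ℂ (KP n N) A'] [IsScalarTower ℂ A' C']
  [IsScalarTower ℂ C C'] [IsScalarTower ℂ B C'] [IsScalarTower ℂ (KP n N) C']

lemma step_smooth [Algebra.Etale (MvPolynomial (Fin n) ℂ) A] [IsNoetherianRing B]
    [Module.Finite A B] [Algebra.Etale A C]
    [Algebra.Etale (KP n N) A'] [Algebra.Etale (KP n N) C'] [Algebra.IsIntegral A A']
    (hPA : ∀ p, algebraMap A C' (algebraMap (MvPolynomial (Fin n) ℂ) A p) =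
      algebraMap (KP n N) C' (algebraMap _ (KP n N) p))
    [IsLocalization.Away
      (∏ j : Fin n, algebraMap A B (algebraMap (MvPolynomial (Fin n) ℂ) A (X j))) C]
    (ρ : KG n N → C' →+* C')
    (S : KSetup (C := C) (fun j => algebraMap A B (algebraMap (MvPolynomial (Fin n) ℂ) A (X j)))
      (fun j => algebraMap (KP n N) C' (KP.t j)) ρ)
    (D : Fin n → Derivation ℂ C C)
    (hD : ∀ i p, D i (algebraMap A C (algebraMap (MvPolynomial (Fin n) ℂ) A p)) =
        algebraMap A C (algebraMap (MvPolynomial (Fin n) ℂ) A (pderiv i p)))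
    (hBC : ∀ c : C, _root_.IsIntegral B c → c ∈ (algebraMap B C).range)
    (hcore : ∀ i (xi : C),
        algebraMap A C (algebraMap (MvPolynomial (Fin n) ℂ) A (X i)) * xi = 1 →
        ∀ (c : C) (a : Fin n → ℕ),
        c ^ N * ∏ j, algebraMap B C (algebraMap A B (algebraMap (MvPolynomial (Fin n) ℂ) A (X j))) ^ a j
          ∈ (algebraMap B C).range →
        (N * D i c + a i * c * xi) ^ N *
          algebraMap B C (algebraMap A B (algebraMap (MvPolynomial (Fin n) ℂ) A (X i))) ^ (N - 1) *
          ∏ j, algebraMap B C (algebraMap A B (algebraMap (MvPolynomial (Fin n) ℂ) A (X j))) ^ a j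
            ∈ (algebraMap B C).range) :
    Algebra.Smooth ℂ (integralClosure B C') := by
  classical
  set x : Fin n → B := fun j => algebraMap A B (algebraMap (MvPolynomial (Fin n) ℂ) A (X j)) with hx
  set t : Fin n → C' := fun j => algebraMap (KP n N) C' (KP.t j) with ht
  have hXu : IsUnit (algebraMap B C (∏ i, x i)) := IsLocalization.Away.algebraMap_isUnit _
  have hxu : ∀ i, ∃ xi, algebraMap B C (x i) * xi = 1 := by
    intro i
    rw [map_prod, IsUnit.prod_univ_iff] at hXu
    exact (hXu i).exists_right_inv
  -- `A'`-structure on `R`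
  have hA'int : ∀ a : A', _root_.IsIntegral B (algebraMap A' C' a) := fun a => by
    have h1 : _root_.IsIntegral A a := Algebra.IsIntegral.isIntegral a
    have h2 : _root_.IsIntegral A (algebraMap A' C' a) := h1.map (IsScalarTower.toAlgHom A A' C')
    exact h2.tower_top
  let φ : A' →+* integralClosure B C' := (algebraMap A' C').codRestrict (integralClosure B C') hA'int
  letI : Algebra A' (integralClosure B C') := φ.toAlgebra
  haveI : IsScalarTower A' (integralClosure B C') C' := IsScalarTower.of_algebraMap_eq fun a => rfl
  haveI : IsScalarTower A A' (integralClosure B C') := IsScalarTower.of_algebraMap_eq fun a =>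
    Subtype.ext (IsScalarTower.algebraMap_apply A A' C' a)
  haveI : IsScalarTower ℂ A' (integralClosure B C') := IsScalarTower.of_algebraMap_eq fun a =>
    Subtype.ext (IsScalarTower.algebraMap_apply ℂ A' C' a)
  haveI : IsScalarTower A B (integralClosure B C') := IsScalarTower.of_algebraMap_eq fun a =>
    Subtype.ext (IsScalarTower.algebraMap_apply A B C' a)
  haveI : Module.Finite B (integralClosure B C') := S.finite hBC hXu
  haveI : Module.Finite A (integralClosure B C') := Module.Finite.trans B _
  haveI : Module.Finite A' (integralClosure B C') := Module.Finite.of_restrictScalars_finite A A' _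
  haveI : IsNoetherianRing A' := Algebra.FiniteType.isNoetherianRing (KP n N) A'
  haveI : Algebra.FormallyEtale A' C' := Algebra.FormallyEtale.of_restrictScalars (R := KP n N)
  haveI : Algebra.FinitePresentation A' C' :=
    Algebra.FinitePresentation.of_restrict_scalars_finitePresentation (KP n N) A' C'
  haveI : Algebra.Etale A' C' := ⟨inferInstance, inferInstance⟩
  -- derivations
  choose DA hDA using fun i : Fin n => exists_lift_der (k := ℂ) (E := A') (KP.der (N := N) i)
  choose E hE using fun i : Fin n => exists_lift_der (k := ℂ) (E := C') (DA i)
  have hEK : ∀ i p, E i (algebraMap (KP n N) C' p) = algebraMap (KP n N) C' (KP.der i p) := fun i p => by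
    rw [IsScalarTower.algebraMap_apply (KP n N) A' C', hE, hDA, ← IsScalarTower.algebraMap_apply]
  have hEt : ∀ i j, E i (t j) = if i = j then 1 else 0 := fun i j => by
    rw [ht]; simp only; rw [hEK, KP.der_t]; split_ifs <;> simp
  have hED : ∀ i c, E i (algebraMap C C' c) = N * t i ^ (N - 1) * algebraMap C C' (D i c) := by
    intro i
    letI : Algebra (MvPolynomial (Fin n) ℂ) C :=
      ((algebraMap A C).comp (algebraMap (MvPolynomial (Fin n) ℂ) A)).toAlgebra
    haveI : IsScalarTower (MvPolynomial (Fin n) ℂ) A C := IsScalarTower.of_algebraMap_eq fun _ => rfl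
    haveI : IsScalarTower ℂ (MvPolynomial (Fin n) ℂ) C := IsScalarTower.of_algebraMap_eq fun w => by
      rw [IsScalarTower.algebraMap_apply (MvPolynomial (Fin n) ℂ) A C,
        ← IsScalarTower.algebraMap_apply ℂ (MvPolynomial (Fin n) ℂ) A,
        ← IsScalarTower.algebraMap_apply]
    haveI : Algebra.FormallyUnramified (MvPolynomial (Fin n) ℂ) C :=
      Algebra.FormallyUnramified.comp _ A C
    let d₁ : Derivation ℂ C C' := (E i).compAlgebraMap C
    let d₂ : Derivation ℂ C C' := (N * t i ^ (N - 1) : C') • (Algebra.linearMap C C').compDer (D i)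
    have : d₁ = d₂ := by
      apply der_unique (P := MvPolynomial (Fin n) ℂ)
      intro p
      change E i (algebraMap C C' (algebraMap A C (algebraMap _ A p))) =
        (N * t i ^ (N - 1) : C') * algebraMap C C' (D i (algebraMap A C (algebraMap _ A p)))
      rw [hD, ← IsScalarTower.algebraMap_apply A C C', ← IsScalarTower.algebraMap_apply A C C', hPA,
        hPA, hEK, KP.der_alg]
      simp [ht]
    intro c
    exact congrArg (fun f => f c) this
  have hER : ∀ i (z : C'), _root_.IsIntegral B z → _root_.IsIntegral B (E i z) := by
    intro i z hz
    obtain ⟨xi, hxi⟩ := hxu i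
    refine S.der_stable hBC i xi hxi (D i) (E i) (hED i) (hEt i) (hcore i xi ?_) z hz
    rw [IsScalarTower.algebraMap_apply A B C]; exact hxi
  let ER : Fin n → Derivation ℂ (integralClosure B C') (integralClosure B C') := fun i =>
    Derivation.mk'
      { toFun := fun r => ⟨E i r, hER i r r.2⟩
        map_add' := fun r s => Subtype.ext (map_add (E i) (r : C') s)
        map_smul' := fun w r => Subtype.ext ((E i).map_smul w (r : C')) }
      (fun r s => Subtype.ext ((E i).leibniz (r : C') s))
  haveI := S.isLocalization
  haveI : IsLocalization.Away (∏ i : Fin n, algebraMap A' (integralClosure B C')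
      (algebraMap (KP n N) A' (KP.t i))) C' := by
    have e : ∀ i, algebraMap A' (integralClosure B C') (algebraMap (KP n N) A' (KP.t i))
        = ⟨t i, S.t_int i⟩ := fun i =>
      Subtype.ext (IsScalarTower.algebraMap_apply (KP n N) A' C' (KP.t i)).symm
    simp only [e]
    infer_instance
  haveI : Algebra.Etale A' (integralClosure B C') :=
    etale_of_derivations (k := ℂ) (C := C') (fun m hm => by
      have : IsUnit (algebraMap ℂ A' m) := (IsUnit.mk0 (m : ℂ) (Nat.cast_ne_zero.mpr hm)).map _
      simpa using this) (fun i => algebraMap (KP n N) A' (KP.t i)) DA ER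
      (fun i a => Subtype.ext (hE i a))
      (fun i j => by rw [hDA, KP.der_t]; split_ifs <;> simp)
      Subtype.val_injective
  haveI : Algebra.Smooth ℂ A' := Algebra.Smooth.comp ℂ (KP n N) A'
  exact Algebra.Smooth.comp ℂ A' _

end Step
end ModP5b

section ModP5c
section Quot
variable {B C C' : Type} [CommRing B] [CommRing C] [CommRing C'] [Algebra B C] [Algebra C C']
  [Algebra B C'] [IsScalarTower B C C'] [Algebra ℂ B] [Algebra ℂ C] [Algebra ℂ C']
  [IsScalarTower ℂ B C] [IsScalarTower ℂ C C'] [IsScalarTower ℂ B C'] {n N : ℕ} [NeZero N]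
  {x : Fin n → B} {t : Fin n → C'} {ρ : KG n N → C' →+* C'}

lemma KSetup.quot (S : KSetup (C := C) x t ρ)
    (hBC : ∀ c : C, _root_.IsIntegral B c → c ∈ (algebraMap B C).range)
    (hinj : Function.Injective (algebraMap B C)) (hs : Algebra.Smooth ℂ (integralClosure B C')) :
    ∃ (R : Type) (_ : CommRing R) (_ : Algebra ℂ R) (_ : Algebra.Smooth ℂ R) (G : Type)
      (_ : Group G) (_ : Finite G) (_ : MulSemiringAction G R) (_ : SMulCommClass G ℂ R),
      Nonempty (B ≃+* fixedSubalgebra G R) := by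
  have hw : ∀ g (w : ℂ) (z : C'), ρ g (w • z) = w • ρ g z := by
    intro g w z
    rw [Algebra.smul_def, map_mul, IsScalarTower.algebraMap_apply ℂ C C', S.ρ_C,
      ← IsScalarTower.algebraMap_apply, ← Algebra.smul_def]
  letI act : MulSemiringAction (KG n N) (integralClosure B C') :=
    { smul := fun g r => ⟨ρ g r, S.ρ_int g r.2⟩
      one_smul := fun r => Subtype.ext (by
        change ρ 1 (r : C') = r
        rw [S.ρ_one]; rfl)
      mul_smul := fun g h r => Subtype.ext (by
        change ρ (g * h) (r : C') = ρ g (ρ h r)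
        rw [S.ρ_mul]; rfl)
      smul_zero := fun g => Subtype.ext (map_zero (ρ g))
      smul_add := fun g r s => Subtype.ext (map_add (ρ g) (r : C') s)
      smul_one := fun g => Subtype.ext (map_one (ρ g))
      smul_mul := fun g r s => Subtype.ext (map_mul (ρ g) (r : C') s) }
  letI comm : SMulCommClass (KG n N) ℂ (integralClosure B C') :=
    ⟨fun g w r => Subtype.ext (hw g w r)⟩
  refine ⟨integralClosure B C', inferInstance, inferInstance, hs, KG n N, inferInstance,
    inferInstance, act, comm, ⟨?_⟩⟩
  let f : B →+* fixedSubalgebra (KG n N) (integralClosure B C') :=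
    (algebraMap B (integralClosure B C')).codRestrict _ (fun b g => Subtype.ext (S.ρ_alg g b))
  refine RingEquiv.ofBijective f ⟨?_, ?_⟩
  · intro b b' h
    have h1 : algebraMap B C' b = algebraMap B C' b' :=
      congrArg (fun r : fixedSubalgebra (KG n N) (integralClosure B C') =>
        ((r : integralClosure B C') : C')) h
    rw [IsScalarTower.algebraMap_apply B C C', IsScalarTower.algebraMap_apply B C C'] at h1
    exact hinj (S.inj h1)
  · rintro ⟨⟨z, hz⟩, hfix⟩
    obtain ⟨c, rfl⟩ := S.fixed z (fun g => congrArg Subtype.val (hfix g))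
    obtain ⟨b, rfl⟩ := S.int_C hBC c hz
    exact ⟨b, Subtype.ext (Subtype.ext (IsScalarTower.algebraMap_apply B C C' b))⟩
end Quot

section Main
open MvPolynomial TensorProduct

lemma KP.isIntegral (n N : ℕ) [NeZero N] (z : KP n N) : _root_.IsIntegral (MvPolynomial (Fin n) ℂ) z := by
  obtain ⟨c, rfl⟩ := KP.span z
  refine IsIntegral.sum _ fun a _ => isIntegral_algebraMap.mul (IsIntegral.prod _ fun i _ =>
    IsIntegral.pow ?_ _)
  apply IsIntegral.of_pow (NeZero.pos N)
  rw [KP.t_pow]; exact isIntegral_algebraMap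

variable {n : ℕ} {A B C : Type} [CommRing A] [CommRing B] [CommRing C]
  [Algebra (MvPolynomial (Fin n) ℂ) A] [Algebra A B] [Algebra B C] [Algebra A C]
  [IsScalarTower A B C] [Algebra ℂ A] [Algebra ℂ B] [Algebra ℂ C]
  [IsScalarTower ℂ (MvPolynomial (Fin n) ℂ) A] [IsScalarTower ℂ A B] [IsScalarTower ℂ B C]
  [IsScalarTower ℂ A C]

theorem main_alg [Algebra.Etale (MvPolynomial (Fin n) ℂ) A]
    [IsDomain B] [IsIntegrallyClosed B] [Module.Finite A B]
    (hX0 : ∏ j : Fin n, algebraMap A B (algebraMap (MvPolynomial (Fin n) ℂ) A (X j)) ≠ 0)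
    [IsLocalization.Away
      (∏ j : Fin n, algebraMap A B (algebraMap (MvPolynomial (Fin n) ℂ) A (X j))) C]
    [Algebra.Etale A C] :
    ∃ (R : Type) (_ : CommRing R) (_ : Algebra ℂ R) (_ : Algebra.Smooth ℂ R) (G : Type)
      (_ : Group G) (_ : Finite G) (_ : MulSemiringAction G R) (_ : SMulCommClass G ℂ R),
      Nonempty (B ≃+* fixedSubalgebra G R) := by
  haveI : IsNoetherianRing A := Algebra.FiniteType.isNoetherianRing (MvPolynomial (Fin n) ℂ) A
  haveI : IsNoetherianRing B := Algebra.FiniteType.isNoetherianRing A B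
  obtain ⟨N, D, hN, hD, hBC, hcore⟩ := step_core (C := C) hX0
  haveI : NeZero N := ⟨hN⟩
  letI : Algebra (MvPolynomial (Fin n) ℂ) C :=
    ((algebraMap A C).comp (algebraMap (MvPolynomial (Fin n) ℂ) A)).toAlgebra
  haveI : IsScalarTower (MvPolynomial (Fin n) ℂ) A C := IsScalarTower.of_algebraMap_eq fun _ => rfl
  haveI : IsScalarTower ℂ (MvPolynomial (Fin n) ℂ) C := IsScalarTower.of_algebraMap_eq fun w => by
    rw [IsScalarTower.algebraMap_apply (MvPolynomial (Fin n) ℂ) A C,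
      ← IsScalarTower.algebraMap_apply ℂ (MvPolynomial (Fin n) ℂ) A,
      ← IsScalarTower.algebraMap_apply]
  haveI : Algebra.Etale (MvPolynomial (Fin n) ℂ) C := Algebra.Etale.comp _ A C
  let A' := KP n N ⊗[MvPolynomial (Fin n) ℂ] A
  let C' := KP n N ⊗[MvPolynomial (Fin n) ℂ] C
  letI : Algebra A A' := Algebra.TensorProduct.rightAlgebra
  letI : Algebra C C' := Algebra.TensorProduct.rightAlgebra
  letI : Algebra A' C' := (Algebra.TensorProduct.map (AlgHom.id (KP n N) (KP n N))
    (IsScalarTower.toAlgHom (MvPolynomial (Fin n) ℂ) A C)).toRingHom.toAlgebra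
  letI : Algebra A C' := ((algebraMap C C').comp (algebraMap A C)).toAlgebra
  letI : Algebra B C' := ((algebraMap C C').comp (algebraMap B C)).toAlgebra
  haveI : IsScalarTower A C C' := IsScalarTower.of_algebraMap_eq fun _ => rfl
  haveI : IsScalarTower B C C' := IsScalarTower.of_algebraMap_eq fun _ => rfl
  have hCC' : ∀ c : C, algebraMap C C' c = 1 ⊗ₜ c := fun c => rfl
  have hAA' : ∀ c : A, algebraMap A A' c = 1 ⊗ₜ c := fun c => rfl
  have hKC' : ∀ c : KP n N, algebraMap (KP n N) C' c = c ⊗ₜ 1 := fun c => rfl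
  have hKA' : ∀ c : KP n N, algebraMap (KP n N) A' c = c ⊗ₜ 1 := fun c => rfl
  have hA'C' : ∀ k a, algebraMap A' C' (k ⊗ₜ a) = k ⊗ₜ algebraMap A C a := fun k a => rfl
  haveI : IsScalarTower A B C' := IsScalarTower.of_algebraMap_eq fun a => by
    rw [IsScalarTower.algebraMap_apply B C C', ← IsScalarTower.algebraMap_apply A B C]; rfl
  haveI : IsScalarTower A A' C' := IsScalarTower.of_algebraMap_eq fun a => by
    rw [hAA', hA'C', IsScalarTower.algebraMap_apply A C C', hCC']
  haveI : IsScalarTower (KP n N) A' C' := IsScalarTower.of_algebraMap_eq fun a => by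
    rw [hKA', hA'C', map_one, hKC']
  have hPC' : ∀ p, algebraMap C C' (algebraMap (MvPolynomial (Fin n) ℂ) C p) =
      algebraMap (KP n N) C' (algebraMap _ (KP n N) p) := fun p => by
    rw [hCC', hKC', Algebra.algebraMap_eq_smul_one, Algebra.algebraMap_eq_smul_one, tmul_smul,
      smul_tmul']
  haveI : IsScalarTower ℂ (KP n N) A' := inferInstance
  haveI : IsScalarTower ℂ (KP n N) C' := inferInstance
  haveI : IsScalarTower ℂ A' C' := IsScalarTower.of_algebraMap_eq fun w => by
    rw [IsScalarTower.algebraMap_apply ℂ (KP n N) A', ← IsScalarTower.algebraMap_apply (KP n N) A' C',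
      ← IsScalarTower.algebraMap_apply]
  haveI : IsScalarTower ℂ C C' := IsScalarTower.of_algebraMap_eq fun w => by
    rw [IsScalarTower.algebraMap_apply ℂ (MvPolynomial (Fin n) ℂ) C, hPC',
      ← IsScalarTower.algebraMap_apply, ← IsScalarTower.algebraMap_apply]
  haveI : IsScalarTower ℂ B C' := IsScalarTower.of_algebraMap_eq fun w => by
    rw [IsScalarTower.algebraMap_apply B C C', ← IsScalarTower.algebraMap_apply ℂ B C,
      ← IsScalarTower.algebraMap_apply]
  haveI : Algebra.IsIntegral A A' := ⟨fun z => by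
    induction z using TensorProduct.induction_on with
    | zero => exact isIntegral_zero
    | add y z hy hz => exact hy.add hz
    | tmul k a =>
      have e : (k ⊗ₜ a : A') = algebraMap (KP n N) A' k * algebraMap A A' a := by
        rw [hKA', hAA', Algebra.TensorProduct.tmul_mul_tmul, mul_one, one_mul]
      rw [e]
      refine IsIntegral.mul ?_ isIntegral_algebraMap
      have h1 : _root_.IsIntegral (MvPolynomial (Fin n) ℂ) (algebraMap (KP n N) A' k) :=
        (KP.isIntegral n N k).map (IsScalarTower.toAlgHom (MvPolynomial (Fin n) ℂ) (KP n N) A')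
      haveI : IsScalarTower (MvPolynomial (Fin n) ℂ) A A' := inferInstance
      exact h1.tower_top⟩
  haveI : Algebra.Etale (KP n N) A' := inferInstance
  haveI : Algebra.Etale (KP n N) C' := inferInstance
  let ρ : KG n N → C' →+* C' := fun g =>
    (Algebra.TensorProduct.map (KP.σ g) (AlgHom.id (MvPolynomial (Fin n) ℂ) C)).toRingHom
  have hρ : ∀ g k c, ρ g (k ⊗ₜ c) = KP.σ g k ⊗ₜ c := fun g k c => rfl
  have S : KSetup (C := C) (fun j => algebraMap A B (algebraMap (MvPolynomial (Fin n) ℂ) A (X j)))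
      (fun j => algebraMap (KP n N) C' (KP.t j)) ρ :=
    { t_pow := fun i => by
        rw [← map_pow, KP.t_pow, ← hPC', IsScalarTower.algebraMap_apply (MvPolynomial (Fin n) ℂ) A C,
          IsScalarTower.algebraMap_apply B C C', ← IsScalarTower.algebraMap_apply A B C]
      inj := by
        haveI : Module.Flat (MvPolynomial (Fin n) ℂ) C := inferInstance
        exact Algebra.TensorProduct.includeRight_injective KP.inj
      span := by
        intro z
        induction z using TensorProduct.induction_on with
        | zero => exact ⟨0, by simp⟩
        | add y z hy hz =>
          obtain ⟨c, hc⟩ := hy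
          obtain ⟨d, hd⟩ := hz
          refine ⟨c + d, ?_⟩
          rw [hc, hd, ← Finset.sum_add_distrib]
          simp only [Pi.add_apply, map_add, add_mul]
        | tmul k a =>
          obtain ⟨c, hc⟩ := KP.span k
          refine ⟨fun u => algebraMap _ C (c u) * a, ?_⟩
          have e : (k ⊗ₜ a : C') = algebraMap (KP n N) C' k * algebraMap C C' a := by
            rw [hKC', hCC', Algebra.TensorProduct.tmul_mul_tmul, mul_one, one_mul]
          rw [e, hc, map_sum, Finset.sum_mul]
          refine Finset.sum_congr rfl fun u _ => ?_
          rw [map_mul, map_mul, hPC', map_prod]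
          simp only [map_pow]
          ring
      ρ_C := fun g c => by rw [hCC', hρ, map_one]
      ρ_t := fun g i => by
        rw [hKC', hρ, KP.σ_t, IsScalarTower.algebraMap_apply ℂ (KP n N) C', hKC',
          Algebra.TensorProduct.tmul_mul_tmul, one_mul]
      ρ_one := by
        have h1 : (KP.σ (1 : KG n N)).restrictScalars ℂ = AlgHom.id ℂ (KP n N) :=
          KP.hom_ext fun i => by simp [KP.σ_t]
        have h2 : ∀ k : KP n N, KP.σ (1 : KG n N) k = k := fun k => congrArg (fun f => f k) h1
        refine RingHom.ext fun z => ?_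
        induction z using TensorProduct.induction_on with
        | zero => simp
        | add y z hy hz => rw [map_add, hy, hz, map_add]
        | tmul k a => rw [hρ, h2]; rfl
      ρ_mul := by
        intro g h
        have h1 : (KP.σ (g * h)).restrictScalars ℂ =
            ((KP.σ g).restrictScalars ℂ).comp ((KP.σ h).restrictScalars ℂ) :=
          KP.hom_ext fun i => by
            simp [KP.σ_t, KP.σ_C]; ring
        have h2 : ∀ k : KP n N, KP.σ (g * h) k = KP.σ g (KP.σ h k) :=
          fun k => congrArg (fun f => f k) h1
        refine RingHom.ext fun z => ?_
        induction z using TensorProduct.induction_on with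
        | zero => simp
        | add y z hy hz => rw [map_add, hy, hz, map_add]
        | tmul k a => rw [hρ, h2]; rfl }
  have hs : Algebra.Smooth ℂ (integralClosure B C') :=
    step_smooth (A := A) (C := C) (A' := A') (N := N) (n := n) (fun p => by
      rw [← hPC', IsScalarTower.algebraMap_apply A C C',
        ← IsScalarTower.algebraMap_apply (MvPolynomial (Fin n) ℂ) A C]) ρ S D hD hBC hcore
  exact S.quot hBC (IsLocalization.injective C
    (powers_le_nonZeroDivisors_of_noZeroDivisors hX0)) hs

end Main
end ModP5c

section ModP6
section Geometry
open AlgebraicGeometry CategoryTheory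

theorem main_hom {n : ℕ} {A B : Type} [CommRing A] [CommRing B]
    (φ : MvPolynomial (Fin n) ℂ →+* A) (hφ : φ.Etale) (ψ : A →+* B) (hψ : ψ.Finite)
    [IsDomain B] [IsIntegrallyClosed B]
    (hX0 : ψ (φ (∏ j, MvPolynomial.X j)) ≠ 0)
    (het : ((algebraMap B (Localization.Away (ψ (φ (∏ j, MvPolynomial.X j))))).comp ψ).Etale) :
    ∃ (R : Type) (_ : CommRing R) (_ : Algebra ℂ R) (_ : Algebra.Smooth ℂ R) (G : Type)
      (_ : Group G) (_ : Finite G) (_ : MulSemiringAction G R) (_ : SMulCommClass G ℂ R),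
      Nonempty (B ≃+* fixedSubalgebra G R) := by
  letI : Algebra (MvPolynomial (Fin n) ℂ) A := φ.toAlgebra
  letI : Algebra A B := ψ.toAlgebra
  letI : Algebra ℂ A := (φ.comp (algebraMap ℂ _)).toAlgebra
  letI : Algebra ℂ B := (ψ.comp (algebraMap ℂ A)).toAlgebra
  haveI : IsScalarTower ℂ (MvPolynomial (Fin n) ℂ) A := IsScalarTower.of_algebraMap_eq fun _ => rfl
  haveI : IsScalarTower ℂ A B := IsScalarTower.of_algebraMap_eq fun _ => rfl
  have e : ψ (φ (∏ j, MvPolynomial.X j)) =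
      ∏ j : Fin n, algebraMap A B (algebraMap (MvPolynomial (Fin n) ℂ) A (MvPolynomial.X j)) := by
    rw [map_prod, map_prod]; rfl
  haveI : Algebra.Etale (MvPolynomial (Fin n) ℂ) A := hφ
  haveI : Module.Finite A B := hψ
  generalize ψ (φ (∏ j, MvPolynomial.X j)) = z at e hX0 het
  subst e
  letI alg : Algebra A (Localization.Away (∏ j : Fin n,
      algebraMap A B (algebraMap (MvPolynomial (Fin n) ℂ) A (MvPolynomial.X j)))) := inferInstance
  haveI : Algebra.Etale A (Localization.Away (∏ j : Fin n,
      algebraMap A B (algebraMap (MvPolynomial (Fin n) ℂ) A (MvPolynomial.X j)))) := by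
    rw [← RingHom.etale_algebraMap]
    have h := IsScalarTower.algebraMap_eq A B (Localization.Away (∏ j : Fin n,
      algebraMap A B (algebraMap (MvPolynomial (Fin n) ℂ) A (MvPolynomial.X j))))
    rw [h]
    exact het
  exact main_alg (C := Localization.Away (∏ j : Fin n,
      algebraMap A B (algebraMap (MvPolynomial (Fin n) ℂ) A (MvPolynomial.X j)))) hX0

lemma intClosed_of_normal {X : Scheme} [IsIntegral X] (hX : IsNormalScheme X) (U : X.Opens)
    (hU : IsAffineOpen U) [Nonempty U] : IsIntegrallyClosed Γ(X, U) := by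
  apply IsIntegrallyClosed.of_localization_maximal
  intro P _ hP
  have hy : hU.fromSpec ⟨P, hP.isPrime⟩ ∈ U := (hU.isoSpec.inv _).2
  letI := TopCat.Presheaf.algebra_section_stalk X.presheaf (⟨_, hy⟩ : U)
  haveI : IsLocalization.AtPrime (X.presheaf.stalk (hU.fromSpec ⟨P, hP.isPrime⟩)) P :=
    hU.isLocalization_stalk' ⟨P, hP.isPrime⟩ hy
  haveI := hX (hU.fromSpec ⟨P, hP.isPrime⟩)
  exact IsIntegrallyClosed.of_equiv (IsLocalization.algEquiv P.primeCompl
    (X.presheaf.stalk (hU.fromSpec ⟨P, hP.isPrime⟩)) (Localization.AtPrime P)).toRingEquiv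

theorem geom (X Y : Scheme) [IsIntegral X] [IsIntegral Y] (hX : IsNormalScheme X) (p : X ⟶ Y)
    [IsFinite p] [IsDominant p] (D : Set Y) (hD : IsSNCDivisor D) (W : Y.Opens)
    (hW : (W : Set Y) = Dᶜ) (het : Etale (p ∣_ W)) : HasFiniteQuotientSingularities X := by
  intro x
  obtain ⟨U, hU, n, s, g, hg, hgs⟩ := hD.2 (p x)
  obtain ⟨V, hV, hxV, hVU⟩ : ∃ V : Y.Opens, IsAffineOpen V ∧ p x ∈ V ∧ V ≤ U := by
    obtain ⟨_, ⟨V, hV, rfl⟩, hxV, hVU⟩ := Y.isBasis_affineOpens.exists_subset_of_mem_open hU U.2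
    exact ⟨V, hV, hxV, hVU⟩
  have hpV : IsAffineOpen (p ⁻¹ᵁ V) := hV.preimage p
  haveI : Nonempty V := ⟨⟨_, hxV⟩⟩
  haveI : Nonempty (p ⁻¹ᵁ V : X.Opens) := ⟨⟨x, hxV⟩⟩
  haveI : Etale g := hg
  let h : Spec Γ(Y, V) ⟶ AffineSpaceC n := hV.isoSpec.inv ≫ Y.homOfLE hVU ≫ g
  haveI : Etale h := inferInstance
  obtain ⟨φ, hφ⟩ : ∃ φ : CommRingCat.of (MvPolynomial (Fin n) ℂ) ⟶ Γ(Y, V), Spec.map φ = h :=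
    ⟨Spec.preimage h, Spec.map_preimage h⟩
  have hφe : φ.hom.Etale := by
    have : Etale (Spec.map φ) := by rw [hφ]; infer_instance
    exact (HasRingHomProperty.Spec_iff (P := @Etale)).mp this
  -- points away from the coordinate hyperplanes
  have hpt : ∀ q : Spec Γ(Y, V), φ.hom (∏ j, MvPolynomial.X j) ∉ q.asIdeal → hV.fromSpec q ∈ W := by
    intro q hq
    let u : V.toScheme := hV.isoSpec.inv q
    have hu1 : U.ι (Y.homOfLE hVU u) = hV.fromSpec q := by
      rw [← Scheme.Hom.comp_apply, Scheme.homOfLE_ι]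
      rfl
    have hu2 : g (Y.homOfLE hVU u) = Spec.map φ q := by
      rw [hφ]
      simp only [h, u, Scheme.Hom.comp_apply]
    rw [← SetLike.mem_coe, hW, Set.mem_compl_iff, ← hu1]
    intro hcon
    have h3 := (hgs _).mpr hcon
    have h4 : Spec.map φ q ∈ coordinateHyperplanes n s := by rw [← hu2]; exact h3
    rw [coordinateHyperplanes, Scheme.zeroLocus_singleton] at h4
    apply h4
    have h6 : φ.hom (∏ i ∈ s, MvPolynomial.X i) ∉ q.asIdeal := fun hc =>
      hq (Ideal.mem_of_dvd _ (map_dvd φ.hom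
        (Finset.prod_dvd_prod_of_subset s Finset.univ _ (Finset.subset_univ s))) hc)
    have h7 := basicOpen_eq_of_affine (R := CommRingCat.of (MvPolynomial (Fin n) ℂ))
      (∏ i ∈ s, MvPolynomial.X i)
    have h8 : Spec.map φ q ∈ PrimeSpectrum.basicOpen
      (∏ i ∈ s, (MvPolynomial.X i : MvPolynomial (Fin n) ℂ)) := h6
    exact (congrArg (fun O : (Spec (CommRingCat.of (MvPolynomial (Fin n) ℂ))).Opens =>
      Spec.map φ q ∈ O) h7).mpr h8
  have hφ0 : φ.hom (∏ j, MvPolynomial.X j) ≠ 0 := by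
    algebraize [φ.hom]
    haveI : Algebra.Etale (MvPolynomial (Fin n) ℂ) Γ(Y, V) := hφe
    have hreg : IsSMulRegular (MvPolynomial (Fin n) ℂ)
        (∏ j, MvPolynomial.X j : MvPolynomial (Fin n) ℂ) :=
      (IsRegular.of_ne_zero (Finset.prod_ne_zero_iff.mpr fun j _ => MvPolynomial.X_ne_zero j)).left.isSMulRegular
    have hreg2 := IsSMulRegular.of_flat (S := Γ(Y, V)) hreg
    intro h0
    have h1 := @hreg2 1 0 (by
      change (φ.hom (∏ j, MvPolynomial.X j)) • (1 : Γ(Y, V)) = (φ.hom (∏ j, MvPolynomial.X j)) • 0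
      rw [h0]; simp)
    exact one_ne_zero h1
  have hX0 : (p.app V).hom (φ.hom (∏ j, MvPolynomial.X j)) ≠ 0 := by
    intro h0
    have h1 : p ⁻¹ᵁ (Y.basicOpen (φ.hom (∏ j, MvPolynomial.X j))) = ⊥ := by
      rw [Scheme.preimage_basicOpen]
      exact (basicOpen_eq_bot_iff _).mpr h0
    have hne : (Y.basicOpen (φ.hom (∏ j, MvPolynomial.X j)) : Set Y).Nonempty := by
      by_contra hcon
      rw [Set.not_nonempty_iff_eq_empty] at hcon
      exact hφ0 ((basicOpen_eq_bot_iff _).mp (TopologicalSpace.Opens.ext hcon))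
    obtain ⟨w, hw⟩ := p.denseRange.exists_mem_open (Y.basicOpen _).2 hne
    have : w ∈ p ⁻¹ᵁ (Y.basicOpen (φ.hom (∏ j, MvPolynomial.X j))) := hw
    rw [h1] at this
    exact this
  haveI := intClosed_of_normal hX (p ⁻¹ᵁ V) hpV
  obtain ⟨R, _, _, hR, G, _, _, _, _, ⟨e⟩⟩ := main_hom φ.hom hφe (p.app V).hom (p.finite_app V hV)
    hX0 (by
      set z := (p.app V).hom (φ.hom (∏ j, MvPolynomial.X j)) with hz
      let ι : Γ(X, p ⁻¹ᵁ V) ⟶ CommRingCat.of (Localization.Away z) := CommRingCat.ofHom (algebraMap _ _)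
      haveI : IsOpenImmersion (Spec.map ι) :=
        IsOpenImmersion.of_isLocalization z
      let j := Spec.map ι ≫ hpV.fromSpec
      haveI : IsOpenImmersion j := inferInstance
      have hcomp : j ≫ p = Spec.map (p.app V ≫ ι) ≫ hV.fromSpec := by
        have := hV.SpecMap_appLE_fromSpec p hpV le_rfl
        rw [Spec.map_comp, Category.assoc, Category.assoc, ← this, Scheme.Hom.appLE_eq_app]
      have hr : Set.range j ⊆ Set.range (p ⁻¹ᵁ W).ι := by
        rintro _ ⟨q, rfl⟩
        rw [Scheme.Opens.range_ι]
        change p (j q) ∈ W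
        rw [← Scheme.Hom.comp_apply, hcomp, Scheme.Hom.comp_apply]
        apply hpt
        intro hcon
        have h5 : ι.hom z ∈ q.asIdeal := hcon
        exact q.2.ne_top (Ideal.eq_top_of_isUnit_mem _ h5
          (IsLocalization.Away.algebraMap_isUnit z))
      let k := IsOpenImmersion.lift (p ⁻¹ᵁ W).ι j hr
      have hk : k ≫ (p ⁻¹ᵁ W).ι = j := IsOpenImmersion.lift_fac _ _ _
      haveI : IsOpenImmersion k := by
        have : IsOpenImmersion (k ≫ (p ⁻¹ᵁ W).ι) := by rw [hk]; infer_instance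
        exact IsOpenImmersion.of_comp k (p ⁻¹ᵁ W).ι
      haveI h1 : Etale (Spec.map (p.app V ≫ ι) ≫ hV.fromSpec) := by
        rw [← hcomp, ← hk, Category.assoc, ← morphismRestrict_ι]
        infer_instance
      have h2 : Etale (Spec.map (p.app V ≫ ι)) := Etale.of_comp _ hV.fromSpec
      exact (HasRingHomProperty.Spec_iff (P := @Etale)).mp h2)
  let ee : Γ(X, p ⁻¹ᵁ V) ≅ CommRingCat.of (fixedSubalgebra G R) := e.toCommRingCatIso
  refine ⟨{ R := R, smooth := hR, G := G, f := Spec.map ee.hom ≫ hpV.fromSpec, etale := ?_, mem := ?_ }⟩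
  · change Etale _
    infer_instance
  · have hx : x ∈ Set.range hpV.fromSpec := by
      rw [hpV.range_fromSpec]; exact hxV
    obtain ⟨y, rfl⟩ := hx
    refine ⟨Spec.map ee.inv y, ?_⟩
    change (Spec.map ee.hom ≫ hpV.fromSpec) (Spec.map ee.inv y) = _
    rw [← Scheme.Hom.comp_apply, ← Category.assoc, ← Spec.map_comp, Iso.hom_inv_id, Spec.map_id,
      Category.id_comp]

end Geometry
end ModP6

/-- The compactified Hurwitz space `H̄(k,b)`, the normalization of the
Fulton–MacPherson configuration space `ℙ¹[b]` in the function field of the Hurwitz space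
`H(k,b)`, has at worst finite quotient singularities. -/
theorem compactified_hurwitz_space_hasFiniteQuotientSingularities
    (k b : ℕ) (W : HurwitzCompactification k b) :
    HasFiniteQuotientSingularities W.Hbar := by
  haveI := W.integralHbar
  haveI := W.integralFM
  haveI := W.pFinite
  haveI := W.pDominant
  exact geom W.Hbar W.FM W.normalHbar W.p W.boundary W.sncBoundary W.interior W.interiorEq
    W.pEtaleInterior
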